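/- Suppose θ : ℕ → ℝ∪{∞} satisfies max(2, n) ≤ θ(n) for all n ≥ 1 and θ(n) ≤ K n² for all n ≥ 1 and some constant K. Then for x ≥ 2: x (log x)^{0.58} ≪ Σ_{n ∈ B_θ, n ≤ x} τ(n) ≪ x (log x)^{0.99998} (with implied constants depending only on K), and moreover L = 1, where L = Σ_{n ∈ B_θ} (τ(n)/n) ∏_{p ≤ θ(n), p prime} (1 − 1/p)². -/

import Mathlib

open Real MeasureTheory
open scoped Classical

/-- The set `B_θ` for `θ : ℕ → ℝ ∪ {∞}` (i.e. `EReal`-valued): `1 ∈ B_θ`, and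
`n = p₁^{α₁}⋯p_k^{α_k}` (with `p₁ < ⋯ < p_k`) belongs to `B_θ` iff
`p_i ≤ θ(p₁^{α₁}⋯p_{i-1}^{α_{i-1}})` for all `i`. -/
def BsetE (θ : ℕ → EReal) : Set ℕ :=
  {n | 0 < n ∧ ∀ p : ℕ, p.Prime → p ∣ n →
    (((p : ℝ) : EReal)) ≤ θ (∏ q ∈ n.primeFactors.filter (· < p), q ^ n.factorization q)}

/-- `∏_{p ≤ y, p prime} (1 - 1/p)²`, as an (unconditionally convergent) infinite product,
so that it equals `0` when `y = ∞`. -/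
noncomputable def ePrimeProdSq (y : EReal) : ℝ :=
  ∏' p : {p : ℕ // p.Prime ∧ ((p : ℝ) : EReal) ≤ y}, (1 - 1 / ((p : ℕ) : ℝ)) ^ 2

/-- `L = ∑_{n ∈ B_θ} τ(n)/n ∏_{p ≤ θ(n)} (1-1/p)²`. -/
noncomputable def Lconst (θ : ℕ → EReal) : ℝ :=
  ∑' n : BsetE θ, ((((n : ℕ).divisors.card : ℝ) / (n : ℕ)) * ePrimeProdSq (θ n))

/-- `T x = ∑_{n ∈ B_θ, n ≤ x} τ(n)`. -/
noncomputable def Tθ (θ : ℕ → EReal) (x : ℝ) : ℝ :=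
  ∑ n ∈ (Finset.Icc 1 ⌊x⌋₊).filter (fun n => n ∈ BsetE θ), (n.divisors.card : ℝ)

/-- sum of reciprocals of primes -/
noncomputable def Sp (N : ℕ) : ℝ := ∑ n ∈ Finset.range (N+1), if n.Prime then 1 / (n:ℝ) else 0

noncomputable def ap (N : ℕ) : ℝ := ∑ n ∈ Finset.range (N+1), if n.Prime then Real.log n / (n:ℝ) else 0

lemma Sp_succ (N : ℕ) : Sp (N+1) = Sp N + if (N+1).Prime then 1 / ((N+1:ℕ):ℝ) else 0 := by
  unfold Sp; rw [Finset.sum_range_succ]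

lemma ap_succ (N : ℕ) : ap (N+1) = ap N + if (N+1).Prime then Real.log (N+1:ℕ) / ((N+1:ℕ):ℝ) else 0 := by
  unfold ap; rw [Finset.sum_range_succ]

lemma Sp_mono : Monotone Sp := by
  apply monotone_nat_of_le_succ
  intro n; rw [Sp_succ]; split_ifs <;> simp; positivity

lemma log_fact_eq (N : ℕ) : Real.log (N.factorial) =
    ∑ n ∈ Finset.range (N+1), if n.Prime then (N.factorial.factorization n : ℝ) * Real.log n else 0 := by
  conv_lhs => rw [← Nat.prod_factorization_pow_eq_self (Nat.factorial_ne_zero N)]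
  rw [Finsupp.prod, Nat.cast_prod, Real.log_prod]
  · rw [← Finset.sum_filter]
    have : (N.factorial.factorization.support) = (Finset.range (N+1)).filter Nat.Prime := by
      ext p
      simp only [Nat.support_factorization, Nat.mem_primeFactors, Finset.mem_filter, Finset.mem_range]
      constructor
      · rintro ⟨h1, h2, h3⟩
        exact ⟨by have := (h1.dvd_factorial).1 h2; omega, h1⟩
      · rintro ⟨h1, h2⟩
        exact ⟨h2, (h2.dvd_factorial).2 (by omega), Nat.factorial_ne_zero N⟩
    rw [this]
    apply Finset.sum_congr rfl
    intro p hp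
    push_cast
    rw [Real.log_pow]
  · intro p hp
    have := Nat.support_factorization (N.factorial) ▸ hp
    have := (Nat.prime_of_mem_primeFactors this).pos
    positivity

lemma log_fact_le (N : ℕ) : Real.log (N.factorial) ≤ N * Real.log N := by
  rw [← Real.log_pow]
  apply Real.log_le_log (by positivity)
  exact_mod_cast Nat.factorial_le_pow N

lemma log_fact_ge (N : ℕ) (hN : 1 ≤ N) : N * Real.log N - N ≤ Real.log (N.factorial) := by
  have h := Stirling.le_log_factorial_stirling (n := N) (by omega)
  have h1 : 0 ≤ Real.log N := Real.log_natCast_nonneg N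
  have h2 : 0 ≤ Real.log (2 * π) := Real.log_nonneg (by nlinarith [Real.pi_gt_three])
  linarith

lemma ap_le (N : ℕ) (hN : 1 ≤ N) : ap N ≤ Real.log N + Real.log 4 := by
  have hN' : (0:ℝ) < N := by positivity
  have h1 : N * ap N - Chebyshev.theta N ≤ Real.log N.factorial := by
    rw [log_fact_eq, ap, Finset.mul_sum, Chebyshev.theta_eq_sum_Icc, Nat.floor_natCast,
      Finset.sum_filter, ← Nat.range_succ_eq_Icc_zero, ← Finset.sum_sub_distrib]
    apply Finset.sum_le_sum
    intro p hp
    split_ifs with h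
    · have h3 : (N / p : ℕ) ≤ N.factorial.factorization p := by
        rw [← h.pow_dvd_iff_le_factorization (Nat.factorial_ne_zero N)]
        rw [h.pow_dvd_factorial_iff (b := N + 1) (by
          exact lt_of_le_of_lt (Nat.log_le_self p N) (by omega))]
        rw [← Nat.pow_one p]
        simp only [pow_one]
        refine le_trans ?_ (Finset.single_le_sum (f := fun i => N / p ^ i) (fun _ _ => Nat.zero_le _) (Finset.mem_Ico.2 ⟨le_refl 1, by omega⟩))
        simp
      have h4 : (N:ℝ) / p - 1 ≤ (N / p : ℕ) := by
        have := Nat.lt_floor_add_one ((N:ℝ)/p)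
        rw [Nat.floor_div_eq_div] at this
        linarith
      have h5 : ((N / p : ℕ):ℝ) ≤ N.factorial.factorization p := by exact_mod_cast h3
      have h6 : 0 ≤ Real.log p := Real.log_natCast_nonneg p
      have : (N:ℝ) * (Real.log p / p) - Real.log p = (N / p - 1) * Real.log p := by ring
      rw [this]; gcongr; linarith
    · simp
  have h2 := log_fact_le N
  have h3 := Chebyshev.theta_le_log4_mul_x (x := N) (by positivity)
  have : N * ap N ≤ N * (Real.log N + Real.log 4) := by linarith
  exact le_of_mul_le_mul_left this hN'

lemma sum_log_bound : ∃ C : ℝ, ∀ N : ℕ, ∑ n ∈ Finset.range (N+1), (if n.Prime then Real.log n / ((n:ℝ) * (n - 1)) else 0) ≤ C := by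
  have hs : Summable (fun n : ℕ => 4 * (1 / (n:ℝ) ^ (3/2:ℝ))) :=
    (Real.summable_one_div_nat_rpow.2 (by norm_num)).mul_left 4
  refine ⟨_, fun N => le_trans (Finset.sum_le_sum (fun n _ => ?_)) (hs.sum_le_tsum (Finset.range (N+1)) (fun n _ => by positivity))⟩
  split_ifs with h
  · have h2 : (2:ℝ) ≤ n := by exact_mod_cast h.two_le
    have h3 : Real.log n ≤ (n:ℝ) ^ (1/2:ℝ) / (1/2) := Real.log_le_rpow_div (by linarith) (by norm_num)
    have h4 : (n:ℝ)^(3/2:ℝ) * (n:ℝ)^(1/2:ℝ) = n ^ 2 := by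
      rw [← Real.rpow_add (by linarith)]; norm_num
    rw [mul_one_div, div_le_div_iff₀ (by nlinarith) (by positivity)]
    have h5 : Real.log n * (n:ℝ)^(3/2:ℝ) ≤ (n:ℝ) ^ (1/2:ℝ) / (1/2) * (n:ℝ)^(3/2:ℝ) := by gcongr
    nlinarith
  · positivity

lemma ap_ge : ∃ C : ℝ, ∀ N : ℕ, 1 ≤ N → Real.log N - C ≤ ap N := by
  obtain ⟨C, hC⟩ := sum_log_bound
  refine ⟨C + 1, fun N hN => ?_⟩
  have hN' : (0:ℝ) < N := by positivity
  have h1 : Real.log N.factorial ≤ N * (ap N + C) := by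
    refine le_trans ?_ (mul_le_mul_of_nonneg_left (add_le_add_right (hC N) _) hN'.le)
    rw [log_fact_eq, ap, ← Finset.sum_add_distrib, Finset.mul_sum]
    apply Finset.sum_le_sum
    intro p hp
    split_ifs with h
    · have h2 : (2:ℝ) ≤ p := by exact_mod_cast h.two_le
      have := Fact.mk h
      have h3 := sub_one_mul_padicValNat_factorial (p := p) N
      have h4 : (p - 1) * (N.factorial.factorization p) ≤ N := by
        rw [Nat.factorization_def _ h, h3]; omega
      have h5 : ((p:ℝ) - 1) * (N.factorial.factorization p) ≤ N := by
        have : (((p - 1 : ℕ)) : ℝ) = (p:ℝ) - 1 := by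
          rw [Nat.cast_sub h.one_le]; simp
        rw [← this]; exact_mod_cast h4
      have h6 : 0 ≤ Real.log p := Real.log_natCast_nonneg p
      have h7 : (N:ℝ) * (Real.log p / p + Real.log p / (p * (p - 1))) = N / (p-1) * Real.log p := by
        have : (p:ℝ) - 1 ≠ 0 := by linarith
        field_simp; ring
      rw [h7]; gcongr
      rw [le_div_iff₀ (by linarith)]; linarith
    · simp
  have h2 := log_fact_ge N hN
  have : N * (Real.log N - (C + 1)) ≤ N * ap N := by linarith
  exact le_of_mul_le_mul_left this hN'

lemma ap_bound : ∃ E : ℝ, 0 ≤ E ∧ ∀ N : ℕ, 1 ≤ N → |ap N - Real.log N| ≤ E := by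
  obtain ⟨C, hC⟩ := ap_ge
  refine ⟨max C (Real.log 4), le_max_of_le_right (Real.log_nonneg (by norm_num)), fun N hN => ?_⟩
  rw [abs_le]
  have h1 := hC N hN
  have h2 := ap_le N hN
  have := le_max_left C (Real.log 4)
  have := le_max_right C (Real.log 4)
  constructor <;> linarith

/-- Mertens' second theorem. -/
lemma mertens2 : ∃ M : ℝ, Filter.Tendsto (fun N : ℕ => Sp N - Real.log (Real.log N)) Filter.atTop (nhds M) := by
  obtain ⟨E, hE0, hE⟩ := ap_bound
  set e : ℕ → ℝ := fun N => ap N - Real.log N with he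
  set F : ℕ → ℝ := fun N => Sp (N+2) - Real.log (Real.log (N+2:ℕ)) - e (N+2) / Real.log (N+2:ℕ) with hF
  set g : ℕ → ℝ := fun N => (E + 1) / Real.log (N+2:ℕ) with hg
  have hlogpos : ∀ N : ℕ, 0 < Real.log (N+2:ℕ) := fun N => Real.log_pos (by push_cast; linarith [Nat.cast_nonneg (α := ℝ) N])
  have hgt : Filter.Tendsto g Filter.atTop (nhds 0) := by
    apply Filter.Tendsto.const_div_atTop
    exact Real.tendsto_log_atTop.comp (tendsto_natCast_atTop_atTop.comp (Filter.tendsto_add_atTop_nat 2))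
  have hstep : ∀ N, |F (N+1) - F N| ≤ g N - g (N+1) := by
    intro N
    have hL1 := hlogpos N
    have hL2 := hlogpos (N+1)
    have eN := hE (N+2) (by omega)
    have hS := Sp_succ (N+2)
    have hA := ap_succ (N+2)
    have hSA : Sp (N+2+1) - Sp (N+2) = (ap (N+2+1) - ap (N+2)) / Real.log (N+1+2:ℕ) := by
      rw [hS, hA]
      have e1 : N+2+1 = N+1+2 := by ring
      rw [e1]
      split_ifs
      · field_simp; ring
      · simp
    have e1 : N+2+1 = N+1+2 := by ring
    rw [e1] at hSA
    set x := Real.log (N+2:ℕ) with hx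
    set y := Real.log (N+1+2:ℕ) with hy
    have hxy : x < y := Real.log_lt_log (by positivity) (by push_cast; linarith)
    have hyx1 : y - x ≤ 1 := by
      rw [hx, hy, ← Real.log_div (by positivity) (by positivity)]
      have : ((N+1+2:ℕ):ℝ) / ((N+2:ℕ):ℝ) ≤ 2 := by
        rw [div_le_iff₀ (by positivity)]; push_cast; linarith [Nat.cast_nonneg (α := ℝ) N]
      calc _ ≤ ((N+1+2:ℕ):ℝ) / ((N+2:ℕ):ℝ) - 1 := Real.log_le_sub_one_of_pos (by positivity)
        _ ≤ 1 := by linarith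
    have hdiff : F (N+1) - F N = ((y - x) / y - (Real.log y - Real.log x)) + e (N+2) * (1 / x - 1 / y) := by
      have : F (N+1) - F N = (Sp (N+1+2) - Sp (N+2)) - (Real.log y - Real.log x) - (e (N+1+2) / y - e (N+2) / x) := by
        simp only [hF]; ring
      rw [this, hSA]
      have h1 : ap (N+1+2) = e (N+1+2) + y := by simp [he, hy]
      have h2 : ap (N+2) = e (N+2) + x := by simp [he, hx]
      rw [h1, h2]; ring
    have hg' : g N - g (N+1) = (E+1) * (1/x - 1/y) := by simp only [hg]; ring
    have hinv : 0 ≤ 1 / x - 1 / y := by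
      rw [sub_nonneg]; exact one_div_le_one_div_of_le hL1 hxy.le
    have hl1 : (y - x) / y ≤ Real.log y - Real.log x := by
      rw [← Real.log_div hL2.ne' hL1.ne']
      have := Real.one_sub_inv_le_log_of_pos (x := y / x) (by positivity)
      have e2 : 1 - (y/x)⁻¹ = (y - x) / y := by field_simp
      linarith
    have hl2 : Real.log y - Real.log x ≤ (y - x) / x := by
      rw [← Real.log_div hL2.ne' hL1.ne']
      have := Real.log_le_sub_one_of_pos (x := y / x) (by positivity)
      have e2 : y/x - 1 = (y - x) / x := by field_simp
      linarith
    have hl3 : (y - x) / x - (y - x) / y ≤ 1 / x - 1 / y := by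
      have : (y - x) / x - (y - x) / y = (y - x) * (1/x - 1/y) := by ring
      rw [this]; nlinarith
    rw [hdiff, hg']
    calc _ ≤ |(y - x) / y - (Real.log y - Real.log x)| + |e (N+2) * (1 / x - 1 / y)| := abs_add_le _ _
      _ ≤ (1/x - 1/y) + E * (1/x - 1/y) := by
        apply add_le_add
        · rw [abs_le]; constructor <;> linarith
        · rw [abs_mul, abs_of_nonneg hinv]; gcongr
      _ = _ := by ring
  have hmono : Monotone (fun N => F N - g N) := by
    apply monotone_nat_of_le_succ
    intro N; have := abs_le.1 (hstep N); linarith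
  have hanti : Antitone (fun N => F N + g N) := by
    apply antitone_nat_of_succ_le
    intro N; have := abs_le.1 (hstep N); linarith
  have hbdd : BddAbove (Set.range (fun N => F N - g N)) := by
    refine ⟨F 0 + g 0, ?_⟩
    rintro _ ⟨N, rfl⟩
    have h1 := hanti (Nat.zero_le N)
    have : 0 ≤ g N := by have := hlogpos N; simp only [hg]; positivity
    simp only at h1 ⊢; linarith
  have hconv := tendsto_atTop_ciSup hmono hbdd
  refine ⟨⨆ N, (F N - g N), ?_⟩
  rw [← Filter.tendsto_add_atTop_iff_nat 2]
  have he0 : Filter.Tendsto (fun N : ℕ => e (N+2) / Real.log (N+2:ℕ)) Filter.atTop (nhds 0) := by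
    apply squeeze_zero_norm _ hgt
    intro N
    rw [Real.norm_eq_abs, abs_div, abs_of_pos (hlogpos N)]
    simp only [hg]
    have := hlogpos N
    gcongr
    linarith [hE (N+2) (by omega)]
  have := (hconv.add hgt).add he0
  simp only [add_zero] at this
  refine this.congr (fun N => ?_)
  simp only [hF]; ring

lemma mertens_ratio : ∃ c : ℝ, 0 < c ∧ Filter.Tendsto (fun N : ℕ => c * Real.exp (Sp N) / Real.log N) Filter.atTop (nhds 1) := by
  obtain ⟨M, hM⟩ := mertens2
  refine ⟨Real.exp (-M), Real.exp_pos _, ?_⟩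
  have h1 : Filter.Tendsto (fun N : ℕ => Real.exp (-M) * Real.exp (Sp N - Real.log (Real.log N))) Filter.atTop (nhds 1) := by
    have h := ((Real.continuous_exp.tendsto M).comp hM).const_mul (Real.exp (-M))
    rw [← Real.exp_add, neg_add_cancel, Real.exp_zero] at h
    exact h
  refine h1.congr' ?_
  filter_upwards [Filter.eventually_ge_atTop 2] with N hN
  have : 0 < Real.log N := Real.log_pos (by exact_mod_cast hN)
  rw [Real.exp_sub, Real.exp_log this]; ring

lemma mertens_bounds : ∃ c1 c2 : ℝ, 0 < c1 ∧ 0 < c2 ∧ ∀ N : ℕ, 2 ≤ N →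
    c1 * Real.log N ≤ Real.exp (Sp N) ∧ Real.exp (Sp N) ≤ c2 * Real.log N := by
  obtain ⟨c, hc, hlim⟩ := mertens_ratio
  have hev := (hlim.eventually (Icc_mem_nhds (show (1/2:ℝ) < 1 by norm_num) (show (1:ℝ) < 2 by norm_num)))
  obtain ⟨N0, hN0⟩ := Filter.eventually_atTop.1 hev
  set Q := max N0 2 with hQ
  have hQpos : 0 < Real.log Q := Real.log_pos (by have : 2 ≤ Q := le_max_right _ _; exact_mod_cast this)
  have hl2 : 0 < Real.log 2 := Real.log_pos (by norm_num)
  refine ⟨min (1 / (2 * c)) (1 / Real.log Q), max (2 / c) (Real.exp (Sp Q) / Real.log 2), by positivity, by positivity, fun N hN => ?_⟩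
  have hN' : (2:ℝ) ≤ N := by exact_mod_cast hN
  have hlog : 0 < Real.log N := Real.log_pos (by linarith)
  by_cases h : N0 ≤ N
  · have h1 := hN0 N h
    rw [le_div_iff₀ hlog, div_le_iff₀ hlog] at h1
    constructor
    · calc _ ≤ 1 / (2*c) * Real.log N := by gcongr; exact min_le_left _ _
        _ ≤ _ := by rw [div_mul_eq_mul_div, div_le_iff₀ (by positivity)]; linarith
    · calc _ ≤ 2 / c * Real.log N := by rw [div_mul_eq_mul_div, le_div_iff₀ (by positivity)]; linarith
        _ ≤ _ := by gcongr; exact le_max_left _ _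
  · have hNQ : N ≤ Q := by have := le_max_left N0 2; omega
    constructor
    · calc _ ≤ 1 / Real.log Q * Real.log N := by gcongr; exact min_le_right _ _
        _ ≤ 1 := by
          rw [div_mul_eq_mul_div, div_le_iff₀ hQpos, one_mul, one_mul]
          apply Real.log_le_log (by linarith); exact_mod_cast hNQ
        _ ≤ _ := by
          apply Real.one_le_exp
          unfold Sp; apply Finset.sum_nonneg; intro n _; split_ifs <;> positivity
    · calc Real.exp (Sp N) ≤ Real.exp (Sp Q) := by apply Real.exp_le_exp.2; exact Sp_mono hNQ
        _ = Real.exp (Sp Q) / Real.log 2 * Real.log 2 := by field_simp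
        _ ≤ Real.exp (Sp Q) / Real.log 2 * Real.log N := by gcongr
        _ ≤ _ := by gcongr; exact le_max_right _ _

noncomputable def partB (n q : ℕ) : ℕ := ∏ r ∈ n.primeFactors.filter (· < q), r ^ n.factorization r

lemma mem_BsetE {θ : ℕ → EReal} {n : ℕ} : n ∈ BsetE θ ↔ 0 < n ∧ ∀ p : ℕ, p.Prime → p ∣ n →
    (((p : ℝ) : EReal)) ≤ θ (partB n p) := Iff.rfl

lemma partB_all {m p : ℕ} (hm : 0 < m) (h : ∀ q : ℕ, q.Prime → q ∣ m → q < p) : partB m p = m := by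
  unfold partB
  rw [Finset.filter_true_of_mem]
  · exact Nat.prod_factorization_pow_eq_self hm.ne'
  · intro q hq; exact h q (Nat.prime_of_mem_primeFactors hq) (Nat.dvd_of_mem_primeFactors hq)

lemma partB_mul {m p a q : ℕ} (hm : 0 < m) (hp : p.Prime) (hq : q ≤ p) :
    partB (m * p ^ a) q = partB m q := by
  unfold partB
  have hpa : p ^ a ≠ 0 := pow_ne_zero _ hp.ne_zero
  have h1 : (m * p ^ a).primeFactors.filter (· < q) = m.primeFactors.filter (· < q) := by
    ext r
    simp only [Finset.mem_filter, Nat.mem_primeFactors]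
    constructor
    · rintro ⟨⟨h1, h2, h3⟩, h4⟩
      refine ⟨⟨h1, ?_, hm.ne'⟩, h4⟩
      rcases (h1.dvd_mul).1 h2 with h | h
      · exact h
      · have := (Nat.prime_dvd_prime_iff_eq h1 hp).1 (h1.dvd_of_dvd_pow h)
        omega
    · rintro ⟨⟨h1, h2, h3⟩, h4⟩
      exact ⟨⟨h1, dvd_mul_of_dvd_left h2 _, mul_ne_zero hm.ne' hpa⟩, h4⟩
  rw [h1]
  apply Finset.prod_congr rfl
  intro r hr
  rw [Finset.mem_filter] at hr
  rw [Nat.factorization_mul hm.ne' hpa, hp.factorization_pow]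
  simp [Finsupp.single_apply, show ¬ (p = r) by omega]

lemma BsetE_mul {θ : ℕ → EReal} {m p a : ℕ} (hm : 0 < m) (hp : p.Prime)
    (h : ∀ q : ℕ, q.Prime → q ∣ m → q < p) (ha : 1 ≤ a) :
    m * p ^ a ∈ BsetE θ ↔ m ∈ BsetE θ ∧ ((p:ℝ):EReal) ≤ θ m := by
  rw [mem_BsetE, mem_BsetE]
  constructor
  · rintro ⟨h0, h1⟩
    refine ⟨⟨hm, fun q hq hqm => ?_⟩, ?_⟩
    · have := h1 q hq (dvd_mul_of_dvd_left hqm _)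
      rwa [partB_mul hm hp (h q hq hqm).le] at this
    · have := h1 p hp (dvd_mul_of_dvd_right (dvd_pow_self p (by omega)) _)
      rwa [partB_mul hm hp le_rfl, partB_all hm h] at this
  · rintro ⟨⟨_, h1⟩, h2⟩
    refine ⟨Nat.mul_pos hm (pow_pos hp.pos _), fun q hq hqm => ?_⟩
    rcases (hq.dvd_mul).1 hqm with h3 | h3
    · rw [partB_mul hm hp (h q hq h3).le]; exact h1 q hq h3
    · have := (Nat.prime_dvd_prime_iff_eq hq hp).1 (hq.dvd_of_dvd_pow h3)
      subst this
      rw [partB_mul hm hp le_rfl, partB_all hm h]; exact h2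

lemma one_mem_BsetE {θ : ℕ → EReal} : 1 ∈ BsetE θ := by
  rw [mem_BsetE]
  refine ⟨one_pos, fun p hp h => ?_⟩
  exact absurd (Nat.dvd_one.1 h) hp.ne_one

/-- strip the largest prime -/
lemma exists_strip {n p : ℕ} (hn : 0 < n) (hp : p.Prime) (hpn : p ∣ n)
    (h : ∀ q : ℕ, q.Prime → q ∣ n → q ≤ p) : ∃ m a : ℕ, 0 < m ∧ 1 ≤ a ∧ n = m * p ^ a ∧
      (∀ q : ℕ, q.Prime → q ∣ m → q < p) ∧ a = n.factorization p := by
  obtain ⟨a, m, hm, rfl⟩ := Nat.exists_eq_pow_mul_and_not_dvd hn.ne' p hp.ne_one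
  have hm0 : 0 < m := Nat.pos_of_mul_pos_left hn
  refine ⟨m, a, hm0, ?_, by ring, ?_, ?_⟩
  · by_contra hc
    have : a = 0 := by omega
    subst this; simp at hpn; exact hm hpn
  · intro q hq hqm
    rcases lt_or_eq_of_le (h q hq (dvd_mul_of_dvd_right hqm _)) with h1 | h1
    · exact h1
    · subst h1; exact absurd hqm hm
  · rw [Nat.factorization_mul (pow_ne_zero _ hp.ne_zero) hm0.ne', hp.factorization_pow]
    simp [Nat.factorization_eq_zero_of_not_dvd hm]

noncomputable def Gs (θ : ℕ → EReal) (A n0 N0 : ℕ) : ℕ → Finset ℕ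
  | 0 => {n0}
  | N+1 => if (N+1).Prime ∧ N0 < N+1 then
      Gs θ A n0 N0 N ∪ (((Gs θ A n0 N0 N).filter (fun m => (((N+1:ℕ):ℝ):EReal) ≤ θ m)) ×ˢ
        Finset.Icc 1 A).image (fun x => x.1 * (N+1) ^ x.2)
    else Gs θ A n0 N0 N

/-- start data -/
def GoodStart (θ : ℕ → EReal) (n0 N0 : ℕ) : Prop :=
  n0 ∈ BsetE θ ∧ ∀ q : ℕ, q.Prime → q ∣ n0 → q ≤ N0

lemma goodStart_one (θ : ℕ → EReal) : GoodStart θ 1 0 :=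
  ⟨one_mem_BsetE, fun q hq h => absurd (Nat.dvd_one.1 h) hq.ne_one⟩

lemma Gs_prop {θ : ℕ → EReal} {A n0 N0 : ℕ} (h0 : GoodStart θ n0 N0) (N : ℕ) :
    ∀ n ∈ Gs θ A n0 N0 N, n ∈ BsetE θ ∧ ∀ q : ℕ, q.Prime → q ∣ n → q ≤ max N N0 := by
  induction N with
  | zero =>
    intro n hn
    simp only [Gs, Finset.mem_singleton] at hn
    subst hn
    exact ⟨h0.1, fun q hq h => le_max_of_le_right (h0.2 q hq h)⟩
  | succ N ih =>
    intro n hn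
    rw [Gs] at hn
    split_ifs at hn with h
    · rw [Finset.mem_union] at hn
      rcases hn with hn | hn
      · exact ⟨(ih n hn).1, fun q hq hqn => le_trans ((ih n hn).2 q hq hqn) (max_le_max (by omega) le_rfl)⟩
      · simp only [Finset.mem_image, Finset.mem_product, Finset.mem_filter, Finset.mem_Icc, Prod.exists] at hn
        obtain ⟨m, a, ⟨⟨h1, h2⟩, h3, h4⟩, rfl⟩ := hn
        have hm := ih m h1
        have hlt : ∀ q : ℕ, q.Prime → q ∣ m → q < N + 1 := by
          intro q hq hqm
          have := hm.2 q hq hqm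
          have : max N N0 < N + 1 := by rw [max_lt_iff]; omega
          omega
        refine ⟨(BsetE_mul hm.1.1 h.1 hlt h3).2 ⟨hm.1, h2⟩, fun q hq hqn => ?_⟩
        rcases (hq.dvd_mul).1 hqn with h5 | h5
        · exact le_trans (hlt q hq h5).le (le_max_left _ _)
        · exact le_trans (Nat.le_of_dvd (by omega) (hq.dvd_of_dvd_pow h5)) (le_max_left _ _)
    · exact ⟨(ih n hn).1, fun q hq hqn => le_trans ((ih n hn).2 q hq hqn) (max_le_max (by omega) le_rfl)⟩

lemma Gs_complete {θ : ℕ → EReal} {A : ℕ} (N : ℕ) :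
    ∀ n ∈ BsetE θ, (∀ q : ℕ, q.Prime → q ∣ n → q ≤ N) → (∀ q : ℕ, n.factorization q ≤ A) →
      n ∈ Gs θ A 1 0 N := by
  induction N with
  | zero =>
    intro n hn h _
    simp only [Gs, Finset.mem_singleton]
    by_contra hc
    obtain ⟨q, hq, hqn⟩ := Nat.exists_prime_and_dvd hc
    have := h q hq hqn
    exact absurd hq.pos (by omega)
  | succ N ih =>
    intro n hn h hA
    by_cases hd : (N+1).Prime ∧ (N+1) ∣ n
    · obtain ⟨m, a, hm, ha, hna, hlt, haf⟩ := exists_strip hn.1 hd.1 hd.2 h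
      have hB := (BsetE_mul hm hd.1 hlt ha).1 (hna ▸ hn)
      rw [Gs, if_pos ⟨hd.1, by omega⟩, Finset.mem_union]
      right
      simp only [Finset.mem_image, Finset.mem_product, Finset.mem_filter, Finset.mem_Icc, Prod.exists]
      refine ⟨m, a, ⟨⟨ih m hB.1 (fun q hq hqm => by have := hlt q hq hqm; omega) (fun q => ?_), hB.2⟩, ha, haf ▸ hA _⟩, hna.symm⟩
      refine le_trans ?_ (hA q)
      exact (Nat.factorization_le_iff_dvd hm.ne' hn.1.ne').2 (hna ▸ dvd_mul_right _ _) q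
    · have : n ∈ Gs θ A 1 0 N := by
        refine ih n hn (fun q hq hqn => ?_) hA
        have h1 := h q hq hqn
        rcases lt_or_eq_of_le h1 with h2 | h2
        · omega
        · subst h2; exact absurd ⟨hq, hqn⟩ hd
      rw [Gs]
      split_ifs
      · exact Finset.mem_union_left _ this
      · exact this

lemma Gs_sum {θ : ℕ → EReal} {A n0 N0 : ℕ} (h0 : GoodStart θ n0 N0) (N : ℕ) (f : ℕ → ℝ) :
    ∑ n ∈ Gs θ A n0 N0 (N+1), f n = ∑ m ∈ Gs θ A n0 N0 N, (f m +
      if ((N+1).Prime ∧ N0 < N+1) ∧ (((N+1:ℕ):ℝ):EReal) ≤ θ m then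
        ∑ a ∈ Finset.Icc 1 A, f (m * (N+1)^a) else 0) := by
  rw [Gs]
  by_cases h : (N+1).Prime ∧ N0 < N+1
  · rw [if_pos h]
    have hlt : ∀ m ∈ Gs θ A n0 N0 N, ¬ (N+1 ∣ m) := by
      intro m hm hd
      have := (Gs_prop h0 N m hm).2 _ h.1 hd
      have : max N N0 < N + 1 := by rw [max_lt_iff]; omega
      omega
    rw [Finset.sum_union, Finset.sum_add_distrib, Finset.sum_image]
    · congr 1
      rw [Finset.sum_product, Finset.sum_filter]
      apply Finset.sum_congr rfl
      intro m hm
      simp [h]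
    · rintro ⟨m, a⟩ hx ⟨m', a'⟩ hx' heq
      simp only [Finset.coe_product, Set.mem_prod, Finset.mem_coe, Finset.mem_filter] at hx hx' heq
      have hm := hlt m hx.1.1
      have hm' := hlt m' hx'.1.1
      have hp := h.1
      have e1 : (m * (N+1)^a).factorization (N+1) = a := by
        rw [Nat.factorization_mul (by rintro rfl; exact hm (dvd_zero _)) (pow_ne_zero _ hp.ne_zero), hp.factorization_pow]
        simp [Nat.factorization_eq_zero_of_not_dvd hm]
      have e2 : (m' * (N+1)^a').factorization (N+1) = a' := by
        rw [Nat.factorization_mul (by rintro rfl; exact hm' (dvd_zero _)) (pow_ne_zero _ hp.ne_zero), hp.factorization_pow]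
        simp [Nat.factorization_eq_zero_of_not_dvd hm']
      have e3 : a = a' := by rw [← e1, ← e2, heq]
      subst e3
      have := Nat.eq_of_mul_eq_mul_right (pow_pos hp.pos a) heq
      rw [this]
    · rw [Finset.disjoint_left]
      intro n hn hn'
      simp only [Finset.mem_image, Finset.mem_product, Finset.mem_filter, Finset.mem_Icc, Prod.exists] at hn'
      obtain ⟨m, a, ⟨_, h3, h4⟩, rfl⟩ := hn'
      exact hlt _ hn (dvd_mul_of_dvd_right (dvd_pow_self _ (by omega)) _)
  · rw [if_neg h]
    apply Finset.sum_congr rfl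
    intro m hm
    rw [if_neg (fun hh => h hh.1), add_zero]

noncomputable def wt (n : ℕ) : ℝ := (n.divisors.card : ℝ) / n

lemma wt_nonneg (n : ℕ) : 0 ≤ wt n := by unfold wt; positivity

lemma wt_mul {m p a : ℕ} (hp : p.Prime) (h : ¬ p ∣ m) :
    wt (m * p ^ a) = wt m * ((a + 1 : ℝ) / (p:ℝ)^a) := by
  unfold wt
  have hc : Nat.Coprime m (p ^ a) := Nat.Coprime.pow_right _ ((hp.coprime_iff_not_dvd.2 h).symm)
  rw [hc.card_divisors_mul, Nat.divisors_prime_pow hp]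
  simp
  ring

lemma Gs_wsum {θ : ℕ → EReal} {A n0 N0 : ℕ} (h0 : GoodStart θ n0 N0) (N : ℕ) (f : ℕ → ℝ) :
    ∑ n ∈ Gs θ A n0 N0 (N+1), wt n * f n = ∑ m ∈ Gs θ A n0 N0 N, wt m * (f m +
      if ((N+1).Prime ∧ N0 < N+1) ∧ (((N+1:ℕ):ℝ):EReal) ≤ θ m then
        ∑ a ∈ Finset.Icc 1 A, (a+1:ℝ)/((N+1:ℕ):ℝ)^a * f (m * (N+1)^a) else 0) := by
  rw [Gs_sum h0]
  apply Finset.sum_congr rfl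
  intro m hm
  rw [mul_add]
  congr 1
  split_ifs with h
  · rw [Finset.mul_sum]
    apply Finset.sum_congr rfl
    intro a ha
    rw [wt_mul h.1.1, mul_assoc]
    intro hd
    have := (Gs_prop h0 N m hm).2 _ h.1.1 hd
    have : max N N0 < N + 1 := by rw [max_lt_iff]; omega
    omega
  · simp

noncomputable def Hu (L t : ℝ) : ℝ := 1 + t / (10 * L) + max 0 (2.1 - L^2 / (2 * t^2))

lemma Hu_ge {L t : ℝ} (hL : 0 < L) (ht : 0 ≤ t) : 1 + t / (10 * L) ≤ Hu L t := by
  unfold Hu; linarith [le_max_left 0 (2.1 - L^2 / (2 * t^2))]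

lemma Hu_ge_one {L t : ℝ} (hL : 0 < L) (ht : 0 ≤ t) : 1 ≤ Hu L t := by
  have := Hu_ge hL ht
  have : 0 ≤ t / (10 * L) := by positivity
  linarith

lemma Hu_le {L t : ℝ} : Hu L t ≤ 3.1 + t / (10 * L) := by
  unfold Hu
  have : max 0 (2.1 - L^2 / (2 * t^2)) ≤ 2.1 := by
    apply max_le (by norm_num)
    have : 0 ≤ L^2 / (2*t^2) := by positivity
    linarith
  linarith

lemma Hu_anti {L L' t : ℝ} (hL : 0 < L) (hLL : L ≤ L') (ht : 0 ≤ t) : Hu L' t ≤ Hu L t := by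
  unfold Hu; gcongr

lemma geo_tail : ∃ C0 : ℝ, 0 < C0 ∧ ∀ (A : ℕ) (p : ℝ), 2 ≤ p →
    ∑ a ∈ Finset.Icc 2 A, ((a:ℝ)+1)^2 / p^a ≤ C0 / p^2 := by
  have hs : Summable (fun n : ℕ => ((n:ℝ)+1)^2 * (1/2:ℝ)^n) := by
    have h2 := summable_pow_mul_geometric_of_norm_lt_one (R := ℝ) 2 (r := 1/2) (by norm_num)
    have h1 := summable_pow_mul_geometric_of_norm_lt_one (R := ℝ) 1 (r := 1/2) (by norm_num)
    have h0 := summable_pow_mul_geometric_of_norm_lt_one (R := ℝ) 0 (r := 1/2) (by norm_num)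
    refine ((h2.add (h1.mul_left 2)).add h0).congr (fun n => ?_)
    ring
  have hpos : 0 ≤ ∑' n : ℕ, ((n:ℝ)+1)^2 * (1/2:ℝ)^n := tsum_nonneg (fun n => by positivity)
  refine ⟨4 * (∑' n : ℕ, ((n:ℝ)+1)^2 * (1/2:ℝ)^n) + 1, by positivity, fun A p hp => ?_⟩
  have hp0 : 0 < p := by linarith
  have h1 : ∑ a ∈ Finset.Icc 2 A, ((a:ℝ)+1)^2 / p^a ≤ ∑ a ∈ Finset.Icc 2 A, (4 / p^2) * (((a:ℝ)+1)^2 * (1/2:ℝ)^a) := by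
    apply Finset.sum_le_sum
    intro a ha
    rw [Finset.mem_Icc] at ha
    obtain ⟨b, rfl⟩ := Nat.exists_eq_add_of_le ha.1
    have : (2:ℝ)^b ≤ p^b := by gcongr
    rw [pow_add, pow_add]
    rw [show (4 / p^2) * ((((2+b:ℕ):ℝ)+1)^2 * ((1/2:ℝ)^2 * (1/2)^b)) = (((2+b:ℕ):ℝ)+1)^2 / (p^2 * 2^b) by
      rw [one_div, inv_pow, inv_pow]; field_simp; norm_num]
    gcongr
  refine h1.trans ?_
  rw [← Finset.mul_sum]
  have h2 := hs.sum_le_tsum (Finset.Icc 2 A) (fun n _ => by positivity)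
  calc _ ≤ 4 / p^2 * ∑' n : ℕ, ((n:ℝ)+1)^2 * (1/2:ℝ)^n := by gcongr
    _ = (4 * ∑' n : ℕ, ((n:ℝ)+1)^2 * (1/2:ℝ)^n) / p^2 := by ring
    _ ≤ _ := by gcongr; linarith

lemma sum_Icc_split (A : ℕ) (f : ℕ → ℝ) (hf : ∀ a, 0 ≤ f a) :
    ∑ a ∈ Finset.Icc 1 A, f a ≤ f 1 + ∑ a ∈ Finset.Icc 2 A, f a := by
  have : Finset.Icc 1 A ⊆ insert 1 (Finset.Icc 2 A) := by
    intro a ha; simp at ha ⊢; omega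
  refine (Finset.sum_le_sum_of_subset_of_nonneg this (fun a _ _ => hf a)).trans ?_
  rw [Finset.sum_insert (by simp)]

lemma upper_ineq {r x C : ℝ} (hr : 0.495 ≤ r) (hx : 0 < x) (hC : 0 ≤ C) (hxC : x * (C + 0.1) ≤ 0.001) :
    3.1 + r * (1 - x + x^2) / 10 - (1 + 2 * x) / (2 * r^2) + 2 * x * (3.1 + (r+1.01)/10 - 1 / (2 * (r+1.01)^2))
      + C * (1 + r) * x^2 ≤ (1 + 1.99 * x) * (3.1 + r / 10 - 1 / (2 * r^2)) := by
  have hr0 : 0 < r := by linarith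
  have h1 : 0.38 - 0.0911 * (r + 1.01) ≤ 1 / (r+1.01)^2 := by
    rw [le_div_iff₀ (by positivity)]
    nlinarith [mul_nonneg (sq_nonneg (r + 1.01 - 2.8)) (show 0 ≤ r + 1.01 + 1.4 by linarith), sq_nonneg (r+1.01)]
  have h2 : -(0.099 * r) + 0.233 - 1 / (r+1.01)^2 - 0.005 * (1 / r^2) + x * r / 10 + C * (1 + r) * x ≤ 0 := by
    have h3 : 0 ≤ 1 / r^2 := by positivity
    have h4 : x * r / 10 + C * (1 + r) * x ≤ 0.001 * (1 + r) := by nlinarith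
    linarith
  have e : (1 + 1.99 * x) * (3.1 + r / 10 - 1 / (2 * r^2)) - (3.1 + r * (1 - x + x^2) / 10 - (1 + 2 * x) / (2 * r^2) + 2 * x * (3.1 + (r+1.01)/10 - 1 / (2 * (r+1.01)^2))
      + C * (1 + r) * x^2) = - x * (-(0.099 * r) + 0.233 - 1 / (r+1.01)^2 - 0.005 * (1 / r^2) + x * r / 10 + C * (1 + r) * x) := by
    field_simp; ring
  nlinarith

lemma Hu_tail {C0 : ℝ} (hC0 : ∀ (A : ℕ) (p : ℝ), 2 ≤ p →
    ∑ a ∈ Finset.Icc 2 A, ((a:ℝ)+1)^2 / p^a ≤ C0 / p^2) {L t l p D : ℝ} (hL : 0 < L) (ht : 0 ≤ t) (hl : 0 ≤ l)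
    (hp : 2 ≤ p) (hD : 3.1 ≤ D) (hlL : l / (10 * L) ≤ D) (A : ℕ) :
    ∑ a ∈ Finset.Icc 1 A, ((a:ℝ)+1)/p^a * Hu L (t + a * l) ≤ 2 / p * Hu L (t + l)
      + D * (1 + t / (10 * L)) * (C0 / p^2) := by
  have hp0 : 0 < p := by linarith
  refine (sum_Icc_split A _ (fun a => ?_)).trans ?_
  · have := Hu_ge_one hL (t := t + a * l) (by positivity)
    positivity
  · have e1 : ((1:ℕ):ℝ) = 1 := by norm_num
    rw [e1, pow_one, one_mul, show (1:ℝ)+1 = 2 by norm_num]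
    gcongr
    calc _ ≤ ∑ a ∈ Finset.Icc 2 A, D * (1 + t / (10 * L)) * (((a:ℝ)+1)^2 / p^a) := by
          apply Finset.sum_le_sum
          intro a ha
          have h1 := Hu_le (L := L) (t := t + a * l)
          have h2 : (t + a * l) / (10 * L) = t / (10*L) + a * (l / (10 * L)) := by ring
          have h3 : 0 ≤ t / (10 * L) := by positivity
          have h4 : (a:ℝ) * (l / (10*L)) ≤ a * D := by gcongr
          have h5 : Hu L (t + a * l) ≤ D * (1 + t / (10 * L)) * (a + 1) := by
            have : (0:ℝ) ≤ a := by positivity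
            nlinarith [mul_nonneg h3 this, mul_nonneg (mul_nonneg h3 this) (show 0 ≤ D by linarith)]
          calc _ ≤ ((a:ℝ)+1)/p^a * (D * (1 + t / (10 * L)) * (a + 1)) := by gcongr
            _ = _ := by ring
      _ = D * (1 + t / (10 * L)) * ∑ a ∈ Finset.Icc 2 A, (((a:ℝ)+1)^2 / p^a) := by rw [Finset.mul_sum]
      _ ≤ _ := by gcongr; exact hC0 A p hp

lemma exp_neg_le {x : ℝ} (h0 : 0 ≤ x) (h1 : x ≤ 1) : Real.exp (-x) ≤ 1 - x + x^2 := by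
  have := (abs_le.1 (Real.abs_exp_sub_one_sub_id_le (x := -x) (by rw [abs_neg, abs_of_nonneg h0]; exact h1))).2
  have e : (-x)^2 = x^2 := by ring
  linarith

set_option maxHeartbeats 1000000 in
lemma upper_step {C0 : ℝ} (hC0' : 0 < C0) (hC0 : ∀ (A : ℕ) (p : ℝ), 2 ≤ p →
    ∑ a ∈ Finset.Icc 2 A, ((a:ℝ)+1)^2 / p^a ≤ C0 / p^2) {L t l p : ℝ} (hL : 0 < L) (hl : 0 ≤ l)
    (hp : 2 ≤ p) (hpC : (4 * C0 + 0.1) * 1000 ≤ p) (hlL : l ≤ 1.01 * L) (ht : 0.495 * (L * Real.exp (1/p)) ≤ t) (A : ℕ) :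
    Hu (L * Real.exp (1/p)) t + ∑ a ∈ Finset.Icc 1 A, ((a:ℝ)+1)/p^a * Hu (L * Real.exp (1/p)) (t + a * l)
      ≤ (1 + 1.99 / p) * Hu L t := by
  have hp0 : 0 < p := by linarith
  set x := 1 / p with hx
  have hx0 : 0 < x := by positivity
  have hx1 : x ≤ 1 := by rw [hx, div_le_one hp0]; linarith
  set e := Real.exp x with he
  have he1 : 1 + x ≤ e := by rw [he]; linarith [Real.add_one_le_exp x]
  have he0 : 0 < e := Real.exp_pos _
  have hLe : L ≤ L * e := by nlinarith
  have hLe0 : 0 < L * e := by positivity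
  have htL : 0.495 * L ≤ t := by nlinarith
  have ht0 : 0 < t := by nlinarith
  have hlL' : l / (10 * (L * e)) ≤ 4 := by
    rw [div_le_iff₀ (by positivity)]; nlinarith
  have h1 := Hu_tail hC0 hLe0 ht0.le hl hp (D := 4) (by norm_num) hlL' A
  set r := t / L with hr
  have hrt : t = r * L := by rw [hr]; field_simp
  have hr0 : 0.495 ≤ r := by rw [hr, le_div_iff₀ hL]; exact htL
  have hr00 : 0 < r := by linarith
  have hre : 0.495 ≤ r / e := by rw [le_div_iff₀ he0]; rw [hrt] at ht; have : 0.495 * e * L ≤ r * L := by linarith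
                                 exact le_of_mul_le_mul_right this hL
  have hee : 1 / e ≤ 1 - x + x^2 := by rw [he, one_div, ← Real.exp_neg]; exact exp_neg_le hx0.le hx1
  have hA : Hu (L * e) t ≤ 3.1 + r * (1 - x + x^2) / 10 - (1 + 2 * x) / (2 * r^2) := by
    unfold Hu
    have e1 : (L * e)^2 / (2 * t^2) = e^2 / (2 * r^2) := by rw [hrt]; field_simp
    have e2 : t / (10 * (L * e)) = r * (1 / e) / 10 := by rw [hrt]; field_simp
    rw [e1, e2, max_eq_right]
    · have h3 : r * (1/e) / 10 ≤ r * (1 - x + x^2) / 10 := by gcongr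
      have h4 : (1 + 2 * x) / (2 * r^2) ≤ e^2 / (2 * r^2) := by gcongr; nlinarith
      linarith
    · rw [sub_nonneg, div_le_iff₀ (by positivity)]
      have : 0.495 * e ≤ r := by rwa [le_div_iff₀ he0] at hre
      nlinarith
  have hB : Hu (L * e) (t + l) ≤ 3.1 + (r+1.01)/10 - 1 / (2 * (r+1.01)^2) := by
    have h2 : Hu (L * e) (t + l) ≤ Hu L (t + l) := Hu_anti hL hLe (by linarith)
    refine h2.trans ?_
    unfold Hu
    have e2 : (t + l) / (10 * L) ≤ (r + 1.01) / 10 := by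
      rw [div_le_div_iff₀ (by positivity) (by norm_num), hrt]; nlinarith
    have e3 : 1 / (2 * (r+1.01)^2) ≤ L^2 / (2 * (t+l)^2) := by
      have h8 : t + l ≤ (r + 1.01) * L := by rw [hrt]; linarith
      have h9 : (t + l)^2 ≤ ((r + 1.01) * L)^2 := pow_le_pow_left₀ (by linarith) h8 2
      have h10 : 0 < (t+l)^2 := by positivity
      rw [div_le_div_iff₀ (by positivity) (by positivity)]
      clear_value x e r
      rw [mul_pow] at h9
      linarith
    have e4 : 1 / (2 * (r+1.01)^2) ≤ 2.1 := by
      rw [div_le_iff₀ (by positivity)]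
      have h8 : (1:ℝ)^2 ≤ (r+1.01)^2 := pow_le_pow_left₀ (by norm_num) (by linarith) 2
      linarith
    have : max 0 (2.1 - L^2 / (2 * (t+l)^2)) ≤ 2.1 - 1 / (2 * (r+1.01)^2) := by
      apply max_le <;> linarith
    linarith
  have hC : Hu L t = 3.1 + r / 10 - 1 / (2 * r^2) := by
    unfold Hu
    have e1 : L^2 / (2 * t^2) = 1 / (2 * r^2) := by rw [hrt]; field_simp
    have e2 : t / (10 * L) = r / 10 := by rw [hrt]; field_simp
    rw [e1, e2, max_eq_right]
    · ring
    · rw [sub_nonneg, div_le_iff₀ (by positivity)]; nlinarith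
  have hxC : x * (4 * C0 + 0.1) ≤ 0.001 := by
    rw [hx, one_div, inv_mul_le_iff₀ hp0]; linarith
  have hfin := upper_ineq hr0 hx0 (show 0 ≤ 4 * C0 by linarith) hxC
  have e5 : t / (10 * (L * e)) ≤ r := by
    rw [hrt, div_le_iff₀ (by positivity)]
    nlinarith [mul_pos hr00 hL]
  have h6 : 4 * (1 + t / (10 * (L * e))) * (C0 / p^2) ≤ 4 * C0 * (1 + r) * x^2 := by
    rw [show 4 * C0 * (1 + r) * x^2 = 4 * (1 + r) * (C0 / p^2) by rw [hx]; field_simp]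
    gcongr
  have h7 : 2 / p * Hu (L * e) (t + l) ≤ 2 * x * (3.1 + (r+1.01)/10 - 1 / (2 * (r+1.01)^2)) := by
    rw [show 2 / p = 2 * x by rw [hx]; ring]
    gcongr
  rw [hC, show 1.99 / p = 1.99 * x by rw [hx]; ring]
  linarith

lemma crude_step {C0 : ℝ} (hC0' : 0 < C0) (hC0 : ∀ (A : ℕ) (p : ℝ), 2 ≤ p →
    ∑ a ∈ Finset.Icc 2 A, ((a:ℝ)+1)^2 / p^a ≤ C0 / p^2) {L L' t l p D : ℝ} (hL : 0 < L) (hLL : L ≤ L') (hl : 0 ≤ l)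
    (hp : 2 ≤ p) (hD : 3.1 ≤ D) (hlL : l / (10 * L) ≤ D) (ht : 0 ≤ t) (A : ℕ) :
    Hu L' t + ∑ a ∈ Finset.Icc 1 A, ((a:ℝ)+1)/p^a * Hu L' (t + a * l)
      ≤ (1 + 2 * D + D * C0) * Hu L t := by
  have hL' : 0 < L' := by linarith
  have hlL' : l / (10 * L') ≤ D := le_trans (by gcongr) hlL
  have h1 := Hu_tail hC0 hL' ht hl hp hD hlL' A
  have h2 := Hu_anti hL hLL ht
  have h3 := Hu_ge hL ht
  have h4 : Hu L' (t + l) ≤ 2 * D * Hu L t := by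
    refine (Hu_anti hL hLL (by linarith)).trans (Hu_le.trans ?_)
    rw [add_div]
    have : 0 ≤ t / (10 * L) := by positivity
    nlinarith
  have h5 : 2 / p * Hu L' (t + l) ≤ 1 * (2 * D * Hu L t) := by
    have : 0 ≤ Hu L' (t+l) := by linarith [Hu_ge_one hL' (t := t + l) (by linarith)]
    gcongr
    rw [div_le_one (by linarith)]; exact hp
  have h6 : t / (10 * L') ≤ t / (10 * L) := by gcongr
  have h7 : D * (1 + t / (10 * L')) * (C0 / p^2) ≤ D * Hu L t * C0 := by
    have hh : 0 ≤ D * Hu L t := mul_nonneg (by linarith) (by linarith [Hu_ge_one hL ht])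
    have h8 : C0 / p^2 ≤ C0 := by apply div_le_self hC0'.le; nlinarith
    have h9 : D * (1 + t / (10 * L')) ≤ D * Hu L t := mul_le_mul_of_nonneg_left (by linarith) (by linarith)
    exact mul_le_mul h9 h8 (by positivity) hh
  linarith

lemma Sp_zero : Sp 0 = 0 := by
  simp [Sp]

lemma Sp_nonneg (N : ℕ) : 0 ≤ Sp N := by
  rw [← Sp_zero]; exact Sp_mono (Nat.zero_le N)

lemma log_mul_pow {m p a : ℕ} (hm : 0 < m) (hp : 0 < p) :
    Real.log ((m * p ^ a : ℕ) : ℝ) = Real.log m + a * Real.log p := by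
  have : (m:ℝ) ≠ 0 := by positivity
  have : (p:ℝ) ≠ 0 := by positivity
  push_cast
  rw [Real.log_mul (by positivity) (by positivity), Real.log_pow]

theorem upper_G (K : ℝ) : ∃ C : ℝ, 0 < C ∧ ∀ θ : ℕ → EReal,
    (∀ n : ℕ, 1 ≤ n → θ n ≤ ((K * (n : ℝ) ^ 2 : ℝ) : EReal)) → ∀ A N : ℕ, 2 ≤ N →
    ∑ n ∈ Gs θ A 1 0 N, wt n ≤ C * (Real.log N) ^ (1.99:ℝ) := by
  obtain ⟨C0, hC0', hC0⟩ := geo_tail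
  obtain ⟨c, hc, hlim⟩ := mertens_ratio
  obtain ⟨c1, c2, hc1, hc2, hcc⟩ := mertens_bounds
  have ev1 : ∀ᶠ N : ℕ in Filter.atTop, |c * Real.exp (Sp N) / Real.log N - 1| < 0.004 := by
    have := (Metric.tendsto_nhds.1 hlim) 0.004 (by norm_num)
    simpa [Real.dist_eq] using this
  have hlogt : Filter.Tendsto (fun N : ℕ => Real.log (N:ℝ)) Filter.atTop Filter.atTop :=
    Real.tendsto_log_atTop.comp tendsto_natCast_atTop_atTop
  have ev2 : ∀ᶠ N : ℕ in Filter.atTop, Real.log K * 250 ≤ Real.log (N:ℝ) := hlogt.eventually_ge_atTop _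
  have ev3 : ∀ᶠ N : ℕ in Filter.atTop, (4 * C0 + 0.1) * 1000 ≤ (N:ℝ) := tendsto_natCast_atTop_atTop.eventually_ge_atTop _
  have ev4 : ∀ᶠ N : ℕ in Filter.atTop, 1000 ≤ (N:ℝ) := tendsto_natCast_atTop_atTop.eventually_ge_atTop _
  obtain ⟨p0, hp0⟩ := Filter.eventually_atTop.1 (ev1.and (ev2.and (ev3.and ev4)))
  set D : ℝ := max 3.1 (Real.log p0 / (10 * c)) with hD
  have hD1 : 3.1 ≤ D := le_max_left _ _
  set Cc : ℝ := 1 + 2 * D + D * C0 with hCc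
  have hCc1 : 1 ≤ Cc := by
    have : 0 ≤ D * C0 := mul_nonneg (by linarith) hC0'.le
    linarith
  set Cm : ℝ := Cc ^ p0 with hCm
  refine ⟨3.1 * Cm * c2 ^ (1.99:ℝ), by positivity, fun θ hθ A => ?_⟩
  set Lf : ℕ → ℝ := fun N => c * Real.exp (Sp N) with hLf
  have hLpos : ∀ N, 0 < Lf N := fun N => by simp only [hLf]; positivity
  have hLc : ∀ N, c ≤ Lf N := fun N => by
    simp only [hLf]
    have : 1 ≤ Real.exp (Sp N) := Real.one_le_exp (Sp_nonneg N)
    nlinarith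
  have hLs : ∀ N, (N+1).Prime → Lf (N+1) = Lf N * Real.exp (1 / ((N+1:ℕ):ℝ)) := fun N h => by
    simp only [hLf]; rw [Sp_succ, if_pos h, Real.exp_add]; ring
  have hLn : ∀ N, ¬ (N+1).Prime → Lf (N+1) = Lf N := fun N h => by
    simp only [hLf]; rw [Sp_succ, if_neg h, add_zero]
  have hgood : ∀ N, p0 ≤ N → 0.996 * Real.log N ≤ Lf N ∧ Lf N ≤ 1.004 * Real.log N := by
    intro N hN
    obtain ⟨h1, -, -, h4⟩ := hp0 N hN
    have hl : 0 < Real.log N := Real.log_pos (by linarith)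
    have h5 := abs_lt.1 h1
    have h6 : Lf N / Real.log N < 1.004 := by simp only [hLf]; linarith
    have h7 : 0.996 < Lf N / Real.log N := by simp only [hLf]; linarith
    rw [div_lt_iff₀ hl] at h6
    rw [lt_div_iff₀ hl] at h7
    exact ⟨h7.le, h6.le⟩
  have key : ∀ N, ∑ n ∈ Gs θ A 1 0 N, wt n * Hu (Lf N) (Real.log n) ≤
      3.1 * Cc ^ (min N p0) * Real.exp (1.99 * Sp N) := by
    intro N
    induction N with
    | zero =>
      simp only [Gs, Finset.sum_singleton, Sp_zero]
      have := Hu_le (L := Lf 0) (t := Real.log (1:ℕ))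
      simp at this ⊢
      simp [wt]
      linarith
    | succ N ih =>
      rw [Gs_wsum (goodStart_one θ)]
      have hmpos : ∀ m ∈ Gs θ A 1 0 N, 0 < m := fun m hm => (Gs_prop (goodStart_one θ) N m hm).1.1
      by_cases hpr : (N+1).Prime
      swap
      · have e : Sp (N+1) = Sp N := by rw [Sp_succ, if_neg hpr, add_zero]
        have hmin : Cc ^ (min N p0) ≤ Cc ^ (min (N+1) p0) := pow_le_pow_right₀ hCc1 (by omega)
        rw [hLn N hpr, e]
        calc _ = ∑ n ∈ Gs θ A 1 0 N, wt n * Hu (Lf N) (Real.log n) := by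
              apply Finset.sum_congr rfl; intro m hm
              rw [if_neg (fun h => hpr h.1.1), add_zero]
          _ ≤ _ := ih
          _ ≤ _ := by gcongr
      set p : ℝ := ((N+1:ℕ):ℝ) with hp
      have hp2 : 2 ≤ p := by rw [hp]; exact_mod_cast hpr.two_le
      have hlp : 0 ≤ Real.log p := Real.log_nonneg (by linarith)
      have hsp : Sp (N+1) = Sp N + 1 / p := by rw [Sp_succ, if_pos hpr]
      have hle : Lf N ≤ Lf (N+1) := by
        simp only [hLf]; gcongr; rw [hsp]; have : 0 ≤ 1 / p := by positivity
        linarith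
      rcases lt_or_ge N p0 with hN | hN
      · have hstep : ∀ m ∈ Gs θ A 1 0 N, wt m * (Hu (Lf (N+1)) (Real.log m) +
            if ((N+1).Prime ∧ 0 < N+1) ∧ ((p:ℝ):EReal) ≤ θ m then
              ∑ a ∈ Finset.Icc 1 A, (a+1:ℝ)/p^a * Hu (Lf (N+1)) (Real.log ((m * (N+1)^a : ℕ):ℝ)) else 0) ≤
            wt m * (Cc * Hu (Lf N) (Real.log m)) := by
          intro m hm
          apply mul_le_mul_of_nonneg_left _ (wt_nonneg m)
          have ht : 0 ≤ Real.log (m:ℝ) := Real.log_natCast_nonneg m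
          have hlL : Real.log p / (10 * Lf N) ≤ D := by
            refine le_trans ?_ (le_max_right _ _)
            have : p ≤ p0 := by rw [hp]; exact_mod_cast hN
            have h3 := hLc N
            have : Real.log p ≤ Real.log p0 := Real.log_le_log (by linarith) this
            have : 0 ≤ Real.log p0 := by linarith
            gcongr
          have hcr := crude_step hC0' hC0 (hLpos N) hle hlp hp2 hD1 hlL ht A
          refine le_trans ?_ hcr
          gcongr
          split_ifs
          · apply le_of_eq
            apply Finset.sum_congr rfl; intro a ha
            rw [log_mul_pow (hmpos m hm) (Nat.succ_pos N)]
          · apply Finset.sum_nonneg; intro a ha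
            have := Hu_ge_one (hLpos (N+1)) (t := Real.log m + a * Real.log p) (by positivity)
            positivity
        refine (Finset.sum_le_sum hstep).trans ?_
        have hmin : min (N+1) p0 = min N p0 + 1 := by omega
        calc _ = Cc * ∑ n ∈ Gs θ A 1 0 N, wt n * Hu (Lf N) (Real.log n) := by
              rw [Finset.mul_sum]; apply Finset.sum_congr rfl; intro m hm; ring
          _ ≤ Cc * (3.1 * Cc ^ (min N p0) * Real.exp (1.99 * Sp N)) := by gcongr
          _ = 3.1 * Cc ^ (min (N+1) p0) * Real.exp (1.99 * Sp N) := by rw [hmin, pow_succ]; ring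
          _ ≤ _ := by gcongr; exact Nat.le_succ N |> Sp_mono
      · obtain ⟨-, h2, h3, h4⟩ := hp0 (N+1) (by omega)
        rw [← hp] at h2 h3 h4
        have hg := hgood (N+1) (by omega)
        rw [← hp] at hg
        have hlp1 : 0 < Real.log p := Real.log_pos (by linarith)
        have hstep : ∀ m ∈ Gs θ A 1 0 N, wt m * (Hu (Lf (N+1)) (Real.log m) +
            if ((N+1).Prime ∧ 0 < N+1) ∧ ((p:ℝ):EReal) ≤ θ m then
              ∑ a ∈ Finset.Icc 1 A, (a+1:ℝ)/p^a * Hu (Lf (N+1)) (Real.log ((m * (N+1)^a : ℕ):ℝ)) else 0) ≤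
            wt m * ((1 + 1.99 / p) * Hu (Lf N) (Real.log m)) := by
          intro m hm
          apply mul_le_mul_of_nonneg_left _ (wt_nonneg m)
          have hm0 := hmpos m hm
          have ht : 0 ≤ Real.log (m:ℝ) := Real.log_natCast_nonneg m
          split_ifs with hif
          · have hKm : p ≤ K * (m:ℝ)^2 := by
              have := hif.2.trans (hθ m hm0)
              exact_mod_cast this
            have hm1 : (0:ℝ) < m := by exact_mod_cast hm0
            have hK : 0 < K := by
              by_contra hK
              push Not at hK
              nlinarith [sq_nonneg (m:ℝ)]
            have hlog : Real.log p ≤ Real.log K + 2 * Real.log m := by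
              have := Real.log_le_log (by linarith) hKm
              rw [Real.log_mul hK.ne' (by positivity), Real.log_pow] at this
              exact_mod_cast this
            have hex : Real.exp (1/p) ≤ 1.002 := by
              have h5 : 1 / p ≤ 0.001 := by rw [div_le_iff₀ (by linarith)]; linarith
              have h6 : 0 ≤ 1 / p := by positivity
              have := (abs_le.1 (Real.abs_exp_sub_one_sub_id_le (x := 1/p) (by rw [abs_of_nonneg h6]; linarith))).2
              nlinarith
            have hL1 : Real.log p ≤ 1.01 * Lf N := by
              have h7 := hg.1
              rw [hLs N hpr] at h7
              have := hLpos N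
              nlinarith
            have ht2 : 0.495 * (Lf N * Real.exp (1/p)) ≤ Real.log m := by
              rw [← hLs N hpr]
              have := hg.2
              linarith
            have hus := upper_step hC0' hC0 (hLpos N) hlp hp2 h3 hL1 ht2 A
            rw [← hLs N hpr] at hus
            refine le_trans (le_of_eq ?_) hus
            congr 1
            apply Finset.sum_congr rfl; intro a ha
            rw [log_mul_pow hm0 (Nat.succ_pos N)]
          · have h5 := Hu_anti (hLpos N) hle ht
            have h6 := Hu_ge_one (hLpos N) ht
            have : 0 ≤ 1.99 / p := by positivity
            nlinarith
        refine (Finset.sum_le_sum hstep).trans ?_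
        have hmin : min (N+1) p0 = min N p0 := by omega
        have hexp : 1 + 1.99 / p ≤ Real.exp (1.99 * (1 / p)) := by
          have := Real.add_one_le_exp (1.99 * (1/p))
          have e : 1.99 / p = 1.99 * (1 / p) := by ring
          linarith
        have hnn : 0 ≤ ∑ n ∈ Gs θ A 1 0 N, wt n * Hu (Lf N) (Real.log n) :=
          Finset.sum_nonneg (fun m hm => mul_nonneg (wt_nonneg m) (by linarith [Hu_ge_one (hLpos N) (Real.log_natCast_nonneg m)]))
        calc _ = (1 + 1.99 / p) * ∑ n ∈ Gs θ A 1 0 N, wt n * Hu (Lf N) (Real.log n) := by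
              rw [Finset.mul_sum]; apply Finset.sum_congr rfl; intro m hm; ring
          _ ≤ Real.exp (1.99 * (1 / p)) * (3.1 * Cc ^ (min N p0) * Real.exp (1.99 * Sp N)) := by gcongr
          _ = _ := by rw [hmin, hsp, mul_add, Real.exp_add]; ring
  intro N hN
  have hlN : 0 < Real.log N := Real.log_pos (by exact_mod_cast hN)
  calc _ ≤ ∑ n ∈ Gs θ A 1 0 N, wt n * Hu (Lf N) (Real.log n) := by
        apply Finset.sum_le_sum
        intro m hm
        have := Hu_ge_one (hLpos N) (Real.log_natCast_nonneg m)
        nlinarith [wt_nonneg m]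
    _ ≤ _ := key N
    _ ≤ 3.1 * Cm * Real.exp (1.99 * Sp N) := by
        gcongr
        exact pow_le_pow_right₀ hCc1 (min_le_right _ _)
    _ = 3.1 * Cm * (Real.exp (Sp N)) ^ (1.99:ℝ) := by rw [← Real.exp_mul, mul_comm (1.99:ℝ)]
    _ ≤ 3.1 * Cm * (c2 * Real.log N) ^ (1.99:ℝ) := by
        gcongr
        exact (hcc N hN).2
    _ = _ := by rw [Real.mul_rpow hc2.le hlN.le]; ring

noncomputable def cA (A p : ℕ) : ℝ := 1 + ∑ a ∈ Finset.Icc 1 A, (a+1:ℝ)/(p:ℝ)^a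

lemma cA_ge (A p : ℕ) : 1 ≤ cA A p := by
  unfold cA
  have : 0 ≤ ∑ a ∈ Finset.Icc 1 A, (a+1:ℝ)/(p:ℝ)^a := Finset.sum_nonneg (fun a _ => by positivity)
  linarith

lemma cA_tendsto {p : ℕ} (hp : p.Prime) :
    Filter.Tendsto (fun A => (cA A p)⁻¹) Filter.atTop (nhds ((1 - 1 / (p:ℝ))^2)) := by
  have hp1 : (1:ℝ) < p := by exact_mod_cast hp.one_lt
  have hr : ‖(1 / (p:ℝ))‖ < 1 := by
    rw [Real.norm_of_nonneg (by positivity), div_lt_one (by linarith)]; exact hp1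
  have h1r : 0 < 1 - 1 / (p:ℝ) := by
    rw [Real.norm_of_nonneg (by positivity)] at hr; linarith
  have h1 := (hasSum_coe_mul_geometric_of_norm_lt_one hr).add (hasSum_geometric_of_norm_lt_one hr)
  have h2 := h1.tendsto_sum_nat.comp (Filter.tendsto_add_atTop_nat 1)
  have h3 : (fun A => cA A p) = (fun n => ∑ i ∈ Finset.range n, ((i:ℝ) * (1 / (p:ℝ))^i + (1 / (p:ℝ))^i)) ∘ (fun a => a + 1) := by
    funext A
    simp only [Function.comp, cA]
    rw [Finset.sum_range_succ', add_comm]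
    congr 1
    · rw [show Finset.Icc 1 A = Finset.Ico 1 (A+1) from rfl, Finset.sum_Ico_eq_sum_range]
      simp only [Nat.add_sub_cancel]
      apply Finset.sum_congr rfl
      intro i hi
      rw [one_div, inv_pow, add_comm 1 i]; push_cast; ring
    · simp
  rw [← h3] at h2
  have h4 := h2.inv₀ (by positivity)
  convert h4 using 2
  set u : ℝ := 1 - 1 / (p:ℝ) with hu
  have e : 1 / (p:ℝ) = 1 - u := by rw [hu]; ring
  rw [e]
  have : u ≠ 0 := h1r.ne'
  field_simp
  ring

noncomputable def PS (z : ℕ) (y : EReal) : Finset ℕ :=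
  (Finset.range (z+1)).filter (fun q => q.Prime ∧ ((q:ℝ):EReal) ≤ y)

lemma mem_PS {z : ℕ} {y : EReal} {q : ℕ} : q ∈ PS z y ↔ q ≤ z ∧ q.Prime ∧ ((q:ℝ):EReal) ≤ y := by
  unfold PS
  rw [Finset.mem_filter, Finset.mem_range, Nat.lt_succ_iff]

noncomputable def PrA (A z : ℕ) (y : EReal) : ℝ := ∏ q ∈ PS z y, (cA A q)⁻¹

lemma PrA_nonneg (A z : ℕ) (y : EReal) : 0 ≤ PrA A z y :=
  Finset.prod_nonneg (fun q _ => by have := cA_ge A q; positivity)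

lemma PS_full {z : ℕ} {y : EReal} (h : ((z:ℝ):EReal) ≤ y) : PS z y = PS z ⊤ := by
  ext q
  simp only [mem_PS, le_top, and_true]
  constructor
  · rintro ⟨h1, h2, _⟩; exact ⟨h1, h2⟩
  · rintro ⟨h1, h2⟩
    exact ⟨h1, h2, le_trans (by exact_mod_cast h1) h⟩

lemma PS_succ_of {z : ℕ} {y : EReal} (hp : (z+1).Prime) (h : (((z+1:ℕ):ℝ):EReal) ≤ y) :
    PS (z+1) y = insert (z+1) (PS z y) := by
  ext q
  simp only [mem_PS, Finset.mem_insert]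
  constructor
  · rintro ⟨h1, h2, h3⟩
    rcases Nat.lt_or_ge z q with h4 | h4
    · left; omega
    · right; exact ⟨h4, h2, h3⟩
  · rintro (rfl | ⟨h1, h2, h3⟩)
    · exact ⟨le_rfl, hp, h⟩
    · exact ⟨by omega, h2, h3⟩

lemma PS_succ_not {z : ℕ} {y : EReal} (h : ¬ ((z+1).Prime ∧ (((z+1:ℕ):ℝ):EReal) ≤ y)) :
    PS (z+1) y = PS z y := by
  ext q
  simp only [mem_PS]
  constructor
  · rintro ⟨h1, h2, h3⟩
    refine ⟨?_, h2, h3⟩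
    by_contra h4
    have : q = z + 1 := by omega
    subst this
    exact h ⟨h2, h3⟩
  · rintro ⟨h1, h2, h3⟩
    exact ⟨by omega, h2, h3⟩

lemma PrA_identity {θ : ℕ → EReal} (hθ : ∀ n : ℕ, 1 ≤ n → ((n:ℝ):EReal) ≤ θ n) (A z : ℕ) :
    ∑ n ∈ Gs θ A 1 0 z, wt n * PrA A z (θ n) = 1 := by
  induction z with
  | zero =>
    have : PS 0 (θ 1) = ∅ := by
      ext q; simp only [mem_PS, Finset.notMem_empty, iff_false]
      rintro ⟨h1, h2, _⟩
      have := h2.pos; omega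
    simp [Gs, PrA, this, wt]
  | succ z ih =>
    rw [Gs_wsum (goodStart_one θ)]
    refine Eq.trans ?_ ih
    apply Finset.sum_congr rfl
    intro m hm
    have hm0 : 0 < m := (Gs_prop (goodStart_one θ) z m hm).1.1
    congr 1
    split_ifs with h
    · obtain ⟨⟨hp, -⟩, hle⟩ := h
      have hz : ((z:ℝ):EReal) ≤ θ m := le_trans (by exact_mod_cast Nat.le_succ z) hle
      have hnot : z + 1 ∉ PS z ⊤ := by simp [mem_PS]
      have e1 : PrA A (z+1) (θ m) = (cA A (z+1))⁻¹ * PrA A z ⊤ := by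
        unfold PrA; rw [PS_succ_of hp hle, PS_full hz, Finset.prod_insert hnot]
      have e2 : PrA A z (θ m) = PrA A z ⊤ := by unfold PrA; rw [PS_full hz]
      have e3 : ∀ a ∈ Finset.Icc 1 A, (a+1:ℝ)/((z+1:ℕ):ℝ)^a * PrA A (z+1) (θ (m * (z+1)^a)) =
          (a+1:ℝ)/((z+1:ℕ):ℝ)^a * ((cA A (z+1))⁻¹ * PrA A z ⊤) := by
        intro a ha
        rw [Finset.mem_Icc] at ha
        congr 1
        have hge : (((z+1:ℕ):ℝ):EReal) ≤ θ (m * (z+1)^a) := by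
          refine le_trans ?_ (hθ _ (by have := Nat.pos_of_ne_zero (pow_ne_zero a (Nat.succ_ne_zero z)); exact Nat.mul_pos hm0 this))
          have h1 : (z+1) ≤ (z+1)^a := Nat.le_self_pow (by omega) _
          have : (z+1) ≤ m * (z+1)^a := h1.trans (Nat.le_mul_of_pos_left _ hm0)
          exact_mod_cast this
        have hz' : ((z:ℝ):EReal) ≤ θ (m * (z+1)^a) := le_trans (by exact_mod_cast Nat.le_succ z) hge
        unfold PrA; rw [PS_succ_of hp hge, PS_full hz', Finset.prod_insert hnot]
      rw [Finset.sum_congr rfl e3, ← Finset.sum_mul, e1, e2]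
      have e4 : ∑ a ∈ Finset.Icc 1 A, (a+1:ℝ)/((z+1:ℕ):ℝ)^a = cA A (z+1) - 1 := by unfold cA; ring
      rw [e4]
      have := cA_ge A (z+1)
      have h0 : cA A (z+1) ≠ 0 := by positivity
      field_simp
      ring
    · rw [add_zero]
      unfold PrA
      rw [PS_succ_not]
      rintro ⟨h1, h2⟩
      exact h ⟨⟨h1, by omega⟩, h2⟩

noncomputable def PrI (z : ℕ) (y : EReal) : ℝ := ∏ q ∈ PS z y, (1 - 1 / (q:ℝ))^2

lemma PrI_nonneg (z : ℕ) (y : EReal) : 0 ≤ PrI z y := Finset.prod_nonneg (fun q _ => sq_nonneg _)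

lemma PrA_tendsto (z : ℕ) (y : EReal) :
    Filter.Tendsto (fun A => PrA A z y) Filter.atTop (nhds (PrI z y)) := by
  unfold PrA PrI
  apply tendsto_finsetProd
  intro q hq
  exact cA_tendsto (mem_PS.1 hq).2.1

lemma ePrimeProdSq_eq {z : ℕ} {y : EReal} (h : y ≤ ((z:ℝ):EReal)) : ePrimeProdSq y = PrI z y := by
  unfold ePrimeProdSq PrI
  have hiff : ∀ q : ℕ, (q.Prime ∧ ((q:ℝ):EReal) ≤ y) ↔ q ∈ PS z y := by
    intro q
    rw [mem_PS]
    constructor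
    · rintro ⟨h1, h2⟩
      exact ⟨by exact_mod_cast h2.trans h, h1, h2⟩
    · rintro ⟨_, h⟩; exact h
  have : (fun q : ℕ => q.Prime ∧ ((q:ℝ):EReal) ≤ y) = (fun q => q ∈ PS z y) := by
    funext q; exact propext (hiff q)
  rw [← Finset.prod_coe_sort (PS z y) (fun q : ℕ => (1 - 1 / (q:ℝ))^2), ← tprod_fintype (L := SummationFilter.unconditional _)]
  exact (Equiv.subtypeEquivRight hiff).tprod_eq (fun q : {q // q ∈ PS z y} => (1 - 1 / ((q:ℕ):ℝ))^2)

lemma PrI_full_le (z : ℕ) : PrI z ⊤ ≤ Real.exp (-2 * Sp z) := by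
  unfold PrI Sp PS
  rw [← Finset.sum_filter, Finset.mul_sum, Real.exp_sum]
  have e : (Finset.range (z+1)).filter (fun q : ℕ => q.Prime ∧ ((q:ℝ):EReal) ≤ ⊤) = (Finset.range (z+1)).filter Nat.Prime := by
    ext; simp
  rw [e]
  apply Finset.prod_le_prod (fun _ _ => sq_nonneg _)
  intro q hq
  have hp : q.Prime := (Finset.mem_filter.1 hq).2
  have hq1 : (1:ℝ) < q := by exact_mod_cast hp.one_lt
  have h1 : 1 - 1 / (q:ℝ) ≤ Real.exp (-(1/(q:ℝ))) := by linarith [Real.add_one_le_exp (-(1/(q:ℝ)))]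
  have h0 : 0 ≤ 1 - 1 / (q:ℝ) := by rw [sub_nonneg, div_le_one (by linarith)]; linarith
  calc _ ≤ (Real.exp (-(1/(q:ℝ))))^2 := by gcongr
    _ = _ := by rw [← Real.exp_nat_mul]; congr 1; push_cast; ring

noncomputable def Bz (θ : ℕ → EReal) (z : ℕ) : Finset ℕ :=
  (Finset.Icc 1 z).filter (fun n => n ∈ BsetE θ ∧ θ n ≤ ((z:ℝ):EReal))

lemma Gs_filter {θ : ℕ → EReal} (hθ : ∀ n : ℕ, 1 ≤ n → ((n:ℝ):EReal) ≤ θ n) {A z : ℕ} (hA : z ≤ A) :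
    (Gs θ A 1 0 z).filter (fun n => θ n ≤ ((z:ℝ):EReal)) = Bz θ z := by
  ext n
  simp only [Finset.mem_filter, Bz, Finset.mem_Icc]
  constructor
  · rintro ⟨h1, h2⟩
    have h3 := (Gs_prop (goodStart_one θ) z n h1).1
    have h4 : 1 ≤ n := h3.1
    refine ⟨⟨h4, ?_⟩, h3, h2⟩
    exact_mod_cast (hθ n h4).trans h2
  · rintro ⟨⟨h1, h2⟩, h3, h4⟩
    refine ⟨Gs_complete z n h3 (fun q _ hq => (Nat.le_of_dvd h1 hq).trans h2) (fun q => ?_), h4⟩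
    exact ((Nat.factorization_lt q (by omega)).le.trans h2).trans hA

theorem L_eq_one {K C : ℝ} {θ : ℕ → EReal} (hθ : ∀ n : ℕ, 1 ≤ n → ((n:ℝ):EReal) ≤ θ n)
    (hK : ∀ n : ℕ, 1 ≤ n → θ n ≤ ((K * (n : ℝ) ^ 2 : ℝ) : EReal))
    (hC : ∀ A N : ℕ, 2 ≤ N → ∑ n ∈ Gs θ A 1 0 N, wt n ≤ C * (Real.log N) ^ (1.99:ℝ)) :
    Lconst θ = 1 := by
  obtain ⟨c1, c2, hc1, hc2, hcc⟩ := mertens_bounds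
  set g : ℕ → ℝ := fun n => wt n * ePrimeProdSq (θ n) with hg
  have hC0 : 0 ≤ C := by
    have h1 := hC 0 2 le_rfl
    have h2 : 0 ≤ ∑ n ∈ Gs θ 0 1 0 2, wt n := Finset.sum_nonneg (fun n _ => wt_nonneg n)
    have h3 : 0 < (Real.log (2:ℕ)) ^ (1.99:ℝ) := Real.rpow_pos_of_pos (Real.log_pos (by norm_num)) _
    by_contra h4
    push Not at h4
    nlinarith
  have hSg : ∀ z, ∑ n ∈ Bz θ z, g n = ∑ n ∈ Bz θ z, wt n * PrI z (θ n) := by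
    intro z
    apply Finset.sum_congr rfl
    intro n hn
    simp only [hg]
    rw [ePrimeProdSq_eq (Finset.mem_filter.1 hn).2.2]
  have hsplit : ∀ z A, z ≤ A → ∑ n ∈ Bz θ z, wt n * PrA A z (θ n) +
      ∑ n ∈ (Gs θ A 1 0 z).filter (fun n => ¬ θ n ≤ ((z:ℝ):EReal)), wt n * PrA A z (θ n) = 1 := by
    intro z A hA
    rw [← Gs_filter hθ hA, Finset.sum_filter_add_sum_filter_not, PrA_identity hθ]
  have hlim : ∀ z, Filter.Tendsto (fun A => ∑ n ∈ Bz θ z, wt n * PrA A z (θ n)) Filter.atTop (nhds (∑ n ∈ Bz θ z, g n)) := by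
    intro z
    rw [hSg]
    apply tendsto_finsetSum
    intro n hn
    exact (PrA_tendsto z (θ n)).const_mul _
  have hup : ∀ z, ∑ n ∈ Bz θ z, g n ≤ 1 := by
    intro z
    apply le_of_tendsto (hlim z)
    filter_upwards [Filter.eventually_ge_atTop z] with A hA
    rw [← hsplit z A hA]
    have : 0 ≤ ∑ n ∈ (Gs θ A 1 0 z).filter (fun n => ¬ θ n ≤ ((z:ℝ):EReal)), wt n * PrA A z (θ n) :=
      Finset.sum_nonneg (fun n _ => mul_nonneg (wt_nonneg n) (PrA_nonneg _ _ _))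
    linarith
  have hlow : ∀ z : ℕ, 2 ≤ z → 1 - C * (Real.log z) ^ (1.99:ℝ) * PrI z ⊤ ≤ ∑ n ∈ Bz θ z, g n := by
    intro z hz
    refine le_of_tendsto_of_tendsto (tendsto_const_nhds.sub ((PrA_tendsto z ⊤).const_mul (C * (Real.log z) ^ (1.99:ℝ)))) (hlim z) ?_
    filter_upwards [Filter.eventually_ge_atTop z] with A hA
    rw [← hsplit z A hA]
    have h1 : ∑ n ∈ (Gs θ A 1 0 z).filter (fun n => ¬ θ n ≤ ((z:ℝ):EReal)), wt n * PrA A z (θ n)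
        = (∑ n ∈ (Gs θ A 1 0 z).filter (fun n => ¬ θ n ≤ ((z:ℝ):EReal)), wt n) * PrA A z ⊤ := by
      rw [Finset.sum_mul]
      apply Finset.sum_congr rfl
      intro n hn
      have h2 := (Finset.mem_filter.1 hn).2
      push Not at h2
      unfold PrA; rw [PS_full h2.le]
    have h3 : ∑ n ∈ (Gs θ A 1 0 z).filter (fun n => ¬ θ n ≤ ((z:ℝ):EReal)), wt n ≤ C * (Real.log z) ^ (1.99:ℝ) :=
      (Finset.sum_le_sum_of_subset_of_nonneg (Finset.filter_subset _ _) (fun n _ _ => wt_nonneg n)).trans (hC A z hz)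
    rw [h1]
    have := mul_le_mul_of_nonneg_right h3 (PrA_nonneg A z ⊤)
    linarith
  have hg0 : ∀ n, 1 ≤ n → 0 ≤ g n := by
    intro n hn
    apply mul_nonneg (wt_nonneg n)
    obtain ⟨z, hz⟩ := exists_nat_ge (K * (n:ℝ)^2)
    rw [ePrimeProdSq_eq ((hK n hn).trans (show _ ≤ ((z:ℝ):EReal) by exact_mod_cast hz))]
    exact PrI_nonneg _ _
  have hmain : Lconst θ = ∑' n : BsetE θ, g n := rfl
  have hfin : ∀ F : Finset (BsetE θ), ∑ n ∈ F, g n ≤ 1 := by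
    intro F
    have : ∃ z : ℕ, ∀ n ∈ F, (n:ℕ) ∈ Bz θ z := by
      have hev : ∀ᶠ z : ℕ in Filter.atTop, ∀ n ∈ F, (n:ℕ) ∈ Bz θ z := by
        rw [Filter.eventually_all_finset]
        intro n hn
        obtain ⟨z0, hz0⟩ := exists_nat_ge (K * ((n:ℕ):ℝ)^2)
        filter_upwards [Filter.eventually_ge_atTop (max z0 n)] with z hz
        have hn1 : 1 ≤ (n:ℕ) := n.2.1
        simp only [Bz, Finset.mem_filter, Finset.mem_Icc]
        refine ⟨⟨hn1, le_trans (le_max_right _ _) hz⟩, n.2, (hK n hn1).trans ?_⟩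
        have : (z0:ℝ) ≤ z := by exact_mod_cast le_trans (le_max_left _ _) hz
        exact_mod_cast hz0.trans this
      exact hev.exists
    obtain ⟨z, hz⟩ := this
    refine le_trans ?_ (hup z)
    rw [← Finset.sum_image (f := g) (s := F) (g := fun n : BsetE θ => (n:ℕ)) (fun a _ b _ h => Subtype.ext h)]
    apply Finset.sum_le_sum_of_subset_of_nonneg
    · intro n hn
      obtain ⟨m, hm, rfl⟩ := Finset.mem_image.1 hn
      exact hz m hm
    · intro n hn _
      exact hg0 n (Finset.mem_Icc.1 (Finset.mem_filter.1 hn).1).1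
  have hgn : ∀ n : BsetE θ, 0 ≤ g n := fun n => hg0 n n.2.1
  have hsum : Summable (fun n : BsetE θ => g n) := summable_of_sum_le hgn hfin
  rw [hmain]
  apply le_antisymm (Real.tsum_le_of_sum_le hgn hfin)
  have hlz : ∀ z : ℕ, ∑ n ∈ Bz θ z, g n ≤ ∑' n : BsetE θ, g n := by
    intro z
    have := hsum.sum_le_tsum ((Bz θ z).subtype (fun n => n ∈ BsetE θ)) (fun n _ => hgn n)
    rw [Finset.sum_subtype_of_mem (f := g)] at this
    · exact this
    · intro n hn; exact (Finset.mem_filter.1 hn).2.1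
  have htend : Filter.Tendsto (fun z : ℕ => 1 - C / c1^2 * (Real.log z) ^ (-0.01:ℝ)) Filter.atTop (nhds (1 - C/c1^2 * 0)) := by
    refine tendsto_const_nhds.sub (Filter.Tendsto.const_mul _ ?_)
    exact (tendsto_rpow_neg_atTop (by norm_num : (0:ℝ) < 0.01)).comp (Real.tendsto_log_atTop.comp tendsto_natCast_atTop_atTop)
  rw [mul_zero, sub_zero] at htend
  apply le_of_tendsto htend
  filter_upwards [Filter.eventually_ge_atTop 2] with z hz
  refine le_trans ?_ ((hlow z hz).trans (hlz z))
  have hl : 0 < Real.log z := Real.log_pos (by exact_mod_cast hz)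
  have h1 := (hcc z hz).1
  have h2 : PrI z ⊤ ≤ 1 / (c1 * Real.log z)^2 := by
    refine (PrI_full_le z).trans ?_
    rw [show -2 * Sp z = -(((2:ℕ):ℝ) * Sp z) by push_cast; ring, Real.exp_neg, Real.exp_nat_mul, ← one_div]
    gcongr
  have h3 : C * (Real.log z) ^ (1.99:ℝ) * PrI z ⊤ ≤ C * (Real.log z) ^ (1.99:ℝ) * (1 / (c1 * Real.log z)^2) := by
    gcongr
  have h4 : C * (Real.log z) ^ (1.99:ℝ) * (1 / (c1 * Real.log z)^2) = C / c1^2 * (Real.log z) ^ (-0.01:ℝ) := by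
    have : (Real.log z) ^ (1.99:ℝ) = (Real.log z) ^ (-0.01:ℝ) * (Real.log z)^2 := by
      rw [← Real.rpow_natCast, ← Real.rpow_add hl]; norm_num
    rw [this]
    field_simp
  linarith

lemma pi_upper {y : ℝ} (hy : 1 < y) : ((⌊y⌋₊.primeCounting : ℕ) : ℝ) ≤ 5 * y / Real.log y := by
  have h1 := Chebyshev.pi_le_log4_mul_div hy
  have hl : 0 < Real.log y := Real.log_pos hy
  have h2 : Real.log √y = Real.log y / 2 := Real.log_sqrt (by linarith)
  have h3 : Real.log √y ≤ √y - 1 := Real.log_le_sub_one_of_pos (Real.sqrt_pos.2 (by linarith))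
  have h4 : √y * √y = y := Real.mul_self_sqrt (by linarith)
  have h5 : √y ≤ 2 * y / Real.log y := by
    rw [le_div_iff₀ hl]
    have := Real.sqrt_nonneg y
    nlinarith
  have h6 : Real.log 4 ≤ 1.39 := by
    rw [show (4:ℝ) = 2^2 by norm_num, Real.log_pow]
    have := Real.log_two_lt_d9
    push_cast; linarith
  have h7 : Real.log 4 * y / Real.log √y ≤ 3 * y / Real.log y := by
    rw [h2, div_le_div_iff₀ (by positivity) hl]
    nlinarith [mul_pos hl (show 0 < y by linarith)]
  have e : 5 * y / Real.log y = 3 * y / Real.log y + 2 * y / Real.log y := by ring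
  linarith

lemma geo_u : ∃ C3 : ℝ, 0 < C3 ∧ ∀ (A : ℕ) (u : ℝ), 0 ≤ u → u ≤ 0.8 →
    ∑ a ∈ Finset.Icc 1 A, ((a:ℝ)+1) * u^a ≤ C3 * u := by
  have hs : Summable (fun n : ℕ => ((n:ℝ)+1) * (0.8:ℝ)^n) := by
    have h1 := summable_pow_mul_geometric_of_norm_lt_one (R := ℝ) 1 (r := 0.8) (by norm_num)
    have h0 := summable_pow_mul_geometric_of_norm_lt_one (R := ℝ) 0 (r := 0.8) (by norm_num)
    refine (h1.add h0).congr (fun n => ?_)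
    ring
  have hpos : 0 ≤ ∑' n : ℕ, ((n:ℝ)+1) * (0.8:ℝ)^n := tsum_nonneg (fun n => by positivity)
  refine ⟨2 * (∑' n : ℕ, ((n:ℝ)+1) * (0.8:ℝ)^n) + 1, by positivity, fun A u hu hu1 => ?_⟩
  have h1 : ∑ a ∈ Finset.Icc 1 A, ((a:ℝ)+1) * u^a ≤ ∑ a ∈ Finset.Icc 1 A, (2 * u) * (((a:ℝ)+1) * (0.8:ℝ)^a) := by
    apply Finset.sum_le_sum
    intro a ha
    rw [Finset.mem_Icc] at ha
    obtain ⟨b, rfl⟩ := Nat.exists_eq_add_of_le ha.1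
    have : u^b ≤ 0.8^b := by gcongr
    rw [pow_add, pow_add, pow_one, pow_one]
    have h3 : u * u^b ≤ (2 * u) * (0.8 * 0.8^b) := by
      have : 0 ≤ u^b := by positivity
      have : u * u^b ≤ u * 0.8^b := by gcongr
      have : 0 ≤ u * 0.8^b := by positivity
      linarith
    calc _ ≤ (((1+b:ℕ):ℝ)+1) * ((2 * u) * (0.8 * 0.8^b)) := by gcongr
      _ = _ := by ring
  refine h1.trans ?_
  rw [← Finset.mul_sum]
  have h2 := hs.sum_le_tsum (Finset.Icc 1 A) (fun n _ => by positivity)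
  calc _ ≤ 2 * u * ∑' n : ℕ, ((n:ℝ)+1) * (0.8:ℝ)^n := by gcongr
    _ ≤ _ := by nlinarith

lemma rankin : ∃ C3 : ℝ, 0 < C3 ∧ ∀ (θ : ℕ → EReal) (A Z : ℕ) (σ : ℝ), 0 ≤ σ → σ ≤ 1/2 →
    (σ * Real.log Z ≤ 1) → ∑ n ∈ Gs θ A 1 0 Z, wt n * (n:ℝ)^σ ≤ Real.exp (C3 * Sp Z) := by
  obtain ⟨C3, hC3, hg⟩ := geo_u
  refine ⟨C3 * 3, by positivity, fun θ A Z σ h0 h1 => ?_⟩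
  induction Z with
  | zero => intro _; simp [Gs, wt, Sp_zero]
  | succ Z ih =>
    intro h2
    have hZ : σ * Real.log Z ≤ 1 := by
      refine le_trans ?_ h2
      rcases Nat.eq_zero_or_pos Z with rfl | hZ
      · simp only [Nat.cast_zero, Real.log_zero, mul_zero]
        have := Real.log_natCast_nonneg (0+1)
        positivity
      · gcongr; omega
    have ih := ih hZ
    rw [Gs_wsum (goodStart_one θ)]
    have hnn : 0 ≤ ∑ n ∈ Gs θ A 1 0 Z, wt n * (n:ℝ)^σ :=
      Finset.sum_nonneg (fun m _ => mul_nonneg (wt_nonneg m) (by positivity))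
    by_cases hpr : (Z+1).Prime
    swap
    · have e : Sp (Z+1) = Sp Z := by rw [Sp_succ, if_neg hpr, add_zero]
      rw [e]
      refine le_trans (le_of_eq ?_) ih
      apply Finset.sum_congr rfl; intro m hm
      rw [if_neg (fun h => hpr h.1.1), add_zero]
    set p : ℝ := ((Z+1:ℕ):ℝ) with hp
    have hp2 : 2 ≤ p := by rw [hp]; exact_mod_cast hpr.two_le
    have hp0 : 0 < p := by linarith
    have hsp : Sp (Z+1) = Sp Z + 1 / p := by rw [Sp_succ, if_pos hpr]
    set u : ℝ := p^σ / p with hu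
    have hu0 : 0 ≤ u := by positivity
    have hpe : p^σ ≤ 3 := by
      rw [Real.rpow_def_of_pos hp0]
      have : Real.exp (Real.log p * σ) ≤ Real.exp 1 := by gcongr; linarith
      have := Real.exp_one_lt_d9
      linarith
    have hu3 : u ≤ 3 * (1 / p) := by
      rw [hu, mul_one_div]; gcongr
    have hu8 : u ≤ 0.8 := by
      have h5 : p^σ ≤ p^(1/2:ℝ) := Real.rpow_le_rpow_of_exponent_le (by linarith) h1
      rw [← Real.sqrt_eq_rpow] at h5
      rw [hu, div_le_iff₀ hp0]
      refine h5.trans ?_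
      rw [Real.sqrt_le_left (by positivity)]
      nlinarith
    have hstep : ∀ m ∈ Gs θ A 1 0 Z, wt m * ((m:ℝ)^σ +
        if ((Z+1).Prime ∧ 0 < Z+1) ∧ ((p:ℝ):EReal) ≤ θ m then
          ∑ a ∈ Finset.Icc 1 A, (a+1:ℝ)/p^a * ((m * (Z+1)^a : ℕ):ℝ)^σ else 0) ≤
        (1 + C3 * 3 * (1 / p)) * (wt m * (m:ℝ)^σ) := by
      intro m hm
      rw [mul_left_comm]
      apply mul_le_mul_of_nonneg_left _ (wt_nonneg m)
      have hms : 0 ≤ (m:ℝ)^σ := by positivity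
      have h6 : (if ((Z+1).Prime ∧ 0 < Z+1) ∧ ((p:ℝ):EReal) ≤ θ m then
          ∑ a ∈ Finset.Icc 1 A, (a+1:ℝ)/p^a * ((m * (Z+1)^a : ℕ):ℝ)^σ else 0) ≤ (m:ℝ)^σ * ∑ a ∈ Finset.Icc 1 A, ((a:ℝ)+1) * u^a := by
        split_ifs
        · rw [Finset.mul_sum]
          apply le_of_eq
          apply Finset.sum_congr rfl
          intro a ha
          rw [Nat.cast_mul, Nat.cast_pow, ← hp, Real.mul_rpow (by positivity) (by positivity), ← Real.rpow_pow_comm hp0.le, hu, div_pow]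
          field_simp
        · apply mul_nonneg hms
          exact Finset.sum_nonneg (fun a _ => by positivity)
      have h7 := hg A u hu0 hu8
      have h8 : ∑ a ∈ Finset.Icc 1 A, ((a:ℝ)+1) * u^a ≤ C3 * 3 * (1/p) := by
        refine h7.trans ?_
        rw [mul_assoc]; gcongr
      have h9 := mul_le_mul_of_nonneg_left h8 hms
      linarith
    refine (Finset.sum_le_sum hstep).trans ?_
    rw [← Finset.mul_sum, hsp, mul_add, Real.exp_add, mul_comm (Real.exp _)]
    have := Real.add_one_le_exp (C3 * 3 * (1/p))
    gcongr
    linarith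

lemma tau_mul_prime {m p : ℕ} (hp : p.Prime) : (m * p).divisors.card ≤ 2 * m.divisors.card := by
  rw [Nat.divisors_mul]
  refine Finset.card_mul_le.trans ?_
  rw [hp.divisors, mul_comm, Finset.card_pair hp.one_lt.ne]

/-- the part with a large prime factor -/
lemma large_part (θ : ℕ → EReal) (N Z : ℕ) :
    ∑ n ∈ (Finset.Icc 1 N).filter (fun n => n ∈ BsetE θ ∧ ¬ ∀ q : ℕ, q.Prime → q ∣ n → q ≤ Z), (n.divisors.card : ℝ) ≤
    ∑ m ∈ (Finset.Icc 1 N).filter (fun n => n ∈ BsetE θ), 2 * (m.divisors.card : ℝ) *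
      (((Finset.Icc 1 (N / m)).filter (fun p => p.Prime ∧ Z < p)).card : ℝ) := by
  set S := (Finset.Icc 1 N).filter (fun n => n ∈ BsetE θ ∧ ¬ ∀ q : ℕ, q.Prime → q ∣ n → q ≤ Z) with hS
  set M := (Finset.Icc 1 N).filter (fun n => n ∈ BsetE θ) with hM
  set Pm : ℕ → Finset ℕ := fun m => (Finset.Icc 1 (N / m)).filter (fun p => p.Prime ∧ Z < p) with hPm
  have hex : ∀ n ∈ S, ∃ x : (_ : ℕ) × ℕ, x ∈ M.sigma Pm ∧ n = x.1 * x.2 := by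
    intro n hn
    simp only [hS, Finset.mem_filter, Finset.mem_Icc] at hn
    obtain ⟨⟨hn1, hnN⟩, hB, hq⟩ := hn
    push Not at hq
    obtain ⟨q, hqp, hqn, hqZ⟩ := hq
    have hne : n.primeFactors.Nonempty := ⟨q, Nat.mem_primeFactors.2 ⟨hqp, hqn, by omega⟩⟩
    set p := n.primeFactors.max' hne with hp
    have hpm := Nat.mem_primeFactors.1 (n.primeFactors.max'_mem hne)
    rw [← hp] at hpm
    have hmax : ∀ r : ℕ, r.Prime → r ∣ n → r ≤ p := fun r hr hrn =>
      Finset.le_max' _ _ (Nat.mem_primeFactors.2 ⟨hr, hrn, by omega⟩)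
    obtain ⟨m, a, hm, ha, hnm, hmp, -⟩ := exists_strip hn1 hpm.1 hpm.2.1 hmax
    obtain ⟨b, rfl⟩ := Nat.exists_eq_add_of_le' ha
    have hB2 : m * p ^ b ∈ BsetE θ := by
      rw [hnm, BsetE_mul hm hpm.1 hmp ha] at hB
      rcases Nat.eq_zero_or_pos b with rfl | hb
      · simpa using hB.1
      · rw [BsetE_mul hm hpm.1 hmp hb]; exact hB
    have hnm2 : n = m * p ^ b * p := by rw [hnm, pow_succ]; ring
    have hpos : 0 < m * p ^ b := hB2.1
    refine ⟨⟨m * p ^ b, p⟩, ?_, hnm2⟩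
    simp only [Finset.mem_sigma, hM, hPm, Finset.mem_filter, Finset.mem_Icc]
    refine ⟨⟨⟨hpos, ?_⟩, hB2⟩, ⟨hpm.1.one_lt.le, ?_⟩, hpm.1, lt_of_lt_of_le hqZ (hmax q hqp hqn)⟩
    · refine le_trans ?_ hnN
      rw [hnm2]; exact Nat.le_mul_of_pos_right _ hpm.1.pos
    · rw [Nat.le_div_iff_mul_le hpos, mul_comm, ← hnm2]; exact hnN
  have hsub : S ⊆ (M.sigma Pm).image (fun x => x.1 * x.2) := by
    intro n hn
    obtain ⟨x, hx, rfl⟩ := hex n hn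
    exact Finset.mem_image_of_mem _ hx
  calc _ ≤ ∑ n ∈ (M.sigma Pm).image (fun x => x.1 * x.2), (n.divisors.card : ℝ) :=
        Finset.sum_le_sum_of_subset_of_nonneg hsub (fun _ _ _ => by positivity)
    _ ≤ ∑ x ∈ M.sigma Pm, ((x.1 * x.2).divisors.card : ℝ) :=
        Finset.sum_image_le_of_nonneg (fun _ _ => by positivity)
    _ ≤ ∑ x ∈ M.sigma Pm, 2 * (x.1.divisors.card : ℝ) := by
        apply Finset.sum_le_sum
        intro x hx
        rw [Finset.mem_sigma] at hx
        exact_mod_cast tau_mul_prime (Finset.mem_filter.1 hx.2).2.1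
    _ = _ := by
        rw [Finset.sum_sigma]
        apply Finset.sum_congr rfl
        intro m hm
        simp only [Finset.sum_const, nsmul_eq_mul, hPm]; ring

lemma bdd_aux (C3 : ℝ) : ∃ D : ℝ, 0 < D ∧ ∀ u : ℝ, 1 ≤ u → u ^ C3 ≤ D * Real.exp (u ^ (0.005:ℝ)) := by
  obtain ⟨k, hk⟩ := exists_nat_ge (200 * C3)
  refine ⟨k.factorial, by positivity, fun u hu => ?_⟩
  set v := u ^ (0.005:ℝ) with hv
  have hv1 : 1 ≤ v := Real.one_le_rpow hu (by norm_num)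
  have h1 := Real.pow_div_factorial_le_exp v (by linarith) k
  rw [div_le_iff₀ (by positivity)] at h1
  have h2 : u ^ C3 = v ^ (200 * C3) := by
    rw [hv, ← Real.rpow_mul (by linarith)]; congr 1; ring
  rw [h2]
  have h3 : v ^ (200 * C3) ≤ v ^ (k:ℝ) := Real.rpow_le_rpow_of_exponent_le hv1 hk
  rw [Real.rpow_natCast] at h3
  linarith

theorem T_upper (K : ℝ) : ∃ C : ℝ, 0 < C ∧ ∀ θ : ℕ → EReal,
    (∀ n : ℕ, 1 ≤ n → θ n ≤ ((K * (n : ℝ) ^ 2 : ℝ) : EReal)) → ∀ x : ℝ, 2 ≤ x →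
    Tθ θ x ≤ C * (x * Real.log x ^ (0.99998 : ℝ)) := by
  obtain ⟨CG, hCG, hG⟩ := upper_G K
  obtain ⟨C3, hC3, hR⟩ := rankin
  obtain ⟨c1, c2, hc1, hc2, hcc⟩ := mertens_bounds
  obtain ⟨D, hD, hDD⟩ := bdd_aux C3
  have hl2 : 0 < Real.log 2 := Real.log_pos (by norm_num)
  set Cs : ℝ := Real.exp 4 * Real.exp 4 / (2 * (Real.log 2) ^ (0.99998:ℝ)) with hCs
  refine ⟨10 * CG + c2 ^ C3 * D + Cs, by positivity, fun θ hθ x hx => ?_⟩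
  set N := ⌊x⌋₊ with hN
  have hx0 : 0 < x := by linarith
  have hNx : (N:ℝ) ≤ x := Nat.floor_le hx0.le
  have hN2 : 2 ≤ N := Nat.le_floor (by exact_mod_cast hx)
  have hlx : 0 < Real.log x := Real.log_pos (by linarith)
  rcases le_or_gt x (Real.exp 4) with hsm | hbig
  · have h1 : Tθ θ x ≤ N * N := by
      unfold Tθ
      calc _ ≤ ∑ n ∈ (Finset.Icc 1 ⌊x⌋₊).filter (fun n => n ∈ BsetE θ), (N:ℝ) := by
            apply Finset.sum_le_sum
            intro n hn
            have := (Finset.mem_Icc.1 (Finset.mem_filter.1 hn).1).2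
            exact_mod_cast (Nat.card_divisors_le_self n).trans this
        _ ≤ ∑ n ∈ (Finset.Icc 1 ⌊x⌋₊), (N:ℝ) :=
            Finset.sum_le_sum_of_subset_of_nonneg (Finset.filter_subset _ _) (fun _ _ _ => by positivity)
        _ = _ := by simp [hN]
    have h2 : (N:ℝ) * N ≤ Real.exp 4 * Real.exp 4 := by
      have := hNx.trans hsm
      gcongr
    have h3 : Real.exp 4 * Real.exp 4 ≤ Cs * (x * Real.log x ^ (0.99998 : ℝ)) := by
      have h4 : 2 * (Real.log 2) ^ (0.99998:ℝ) ≤ x * Real.log x ^ (0.99998 : ℝ) := by gcongr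
      rw [hCs, div_mul_eq_mul_div, le_div_iff₀ (by positivity)]
      gcongr
    have h5 : 0 ≤ (10 * CG + c2 ^ C3 * D) * (x * Real.log x ^ (0.99998 : ℝ)) := by positivity
    linarith
  have hl4 : 4 < Real.log x := by rwa [Real.lt_log_iff_exp_lt hx0]
  set u := Real.log x with hu
  set lz := u ^ (0.995:ℝ) with hlz
  have hlz2 : 2 ≤ lz := by
    have h1 : (4:ℝ) ^ (0.5:ℝ) ≤ 4 ^ (0.995:ℝ) := Real.rpow_le_rpow_of_exponent_le (by norm_num) (by norm_num)
    have h2 : (4:ℝ) ^ (0.995:ℝ) ≤ lz := by rw [hlz]; gcongr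
    have h3 : (4:ℝ) ^ (0.5:ℝ) = 2 := by
      rw [show (4:ℝ) = 2 ^ (2:ℝ) by norm_num, ← Real.rpow_mul (by norm_num)]; norm_num
    linarith
  have hlzu : lz ≤ u := by
    calc lz ≤ u ^ (1:ℝ) := Real.rpow_le_rpow_of_exponent_le (by linarith) (by norm_num)
      _ = u := Real.rpow_one u
  set Z := ⌊Real.exp lz⌋₊ with hZ
  have hZN : Z ≤ N := by
    apply Nat.floor_le_floor
    rw [← Real.exp_log hx0]; gcongr
  have hsplit : Tθ θ x = ∑ n ∈ (Finset.Icc 1 N).filter (fun n => n ∈ BsetE θ ∧ ¬ ∀ q : ℕ, q.Prime → q ∣ n → q ≤ Z), (n.divisors.card : ℝ)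
      + ∑ n ∈ (Finset.Icc 1 N).filter (fun n => n ∈ BsetE θ ∧ ∀ q : ℕ, q.Prime → q ∣ n → q ≤ Z), (n.divisors.card : ℝ) := by
    unfold Tθ
    rw [← Finset.sum_filter_not_add_sum_filter _ (fun n => ∀ q : ℕ, q.Prime → q ∣ n → q ≤ Z), Finset.filter_filter, Finset.filter_filter]
  have hfac : ∀ n, 1 ≤ n → n ≤ N → ∀ q, n.factorization q ≤ N := fun n h1 h2 q =>
    (Nat.factorization_lt q (by omega)).le.trans h2
  have hWt : ∑ m ∈ (Finset.Icc 1 N).filter (fun n => n ∈ BsetE θ), wt m ≤ CG * u ^ (1.99:ℝ) := by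
    calc _ ≤ ∑ m ∈ Gs θ N 1 0 N, wt m := by
          apply Finset.sum_le_sum_of_subset_of_nonneg
          · intro n hn
            simp only [Finset.mem_filter, Finset.mem_Icc] at hn
            exact Gs_complete N n hn.2 (fun q _ hq => (Nat.le_of_dvd hn.1.1 hq).trans hn.1.2) (hfac n hn.1.1 hn.1.2)
          · intro n _ _; exact wt_nonneg n
      _ ≤ CG * (Real.log N) ^ (1.99:ℝ) := hG θ hθ N N hN2
      _ ≤ _ := by
          have : Real.log N ≤ u := Real.log_le_log (by positivity) hNx
          have := Real.log_natCast_nonneg N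
          gcongr
  have ha : ∑ n ∈ (Finset.Icc 1 N).filter (fun n => n ∈ BsetE θ ∧ ¬ ∀ q : ℕ, q.Prime → q ∣ n → q ≤ Z), (n.divisors.card : ℝ)
      ≤ 10 * CG * (x * u ^ (0.99998:ℝ)) := by
    refine (large_part θ N Z).trans ?_
    have hterm : ∀ m ∈ (Finset.Icc 1 N).filter (fun n => n ∈ BsetE θ), 2 * (m.divisors.card : ℝ) *
      (((Finset.Icc 1 (N / m)).filter (fun p => p.Prime ∧ Z < p)).card : ℝ) ≤ (10 * x / lz) * wt m := by
      intro m hm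
      have hm1 : 1 ≤ m := (Finset.mem_Icc.1 (Finset.mem_filter.1 hm).1).1
      have hm0 : (0:ℝ) < m := by exact_mod_cast hm1
      have hcount : (((Finset.Icc 1 (N / m)).filter (fun p => p.Prime ∧ Z < p)).card : ℝ) ≤ 5 * (x / m) / lz := by
        rcases Nat.lt_or_ge Z (N / m) with hlt | hge
        swap
        · rw [Finset.filter_false_of_mem]
          · simp; positivity
          · intro p hp h; have := (Finset.mem_Icc.1 hp).2; omega
        have hdiv : ((N / m : ℕ):ℝ) ≤ x / m := (Nat.cast_div_le).trans (by gcongr)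
        have hxm : Real.exp lz ≤ x / m := by
          have := Nat.lt_floor_add_one (Real.exp lz)
          rw [← hZ] at this
          have h2 : ((Z:ℝ)+1) ≤ ((N / m : ℕ):ℝ) := by exact_mod_cast hlt
          linarith
        have h1 : 1 < x / m := lt_of_lt_of_le (Real.one_lt_exp_iff.2 (by linarith)) hxm
        have h2 := pi_upper h1
        have h3 : ((Finset.Icc 1 (N / m)).filter (fun p => p.Prime ∧ Z < p)).card ≤ ⌊x / m⌋₊.primeCounting := by
          rw [Nat.primeCounting, Nat.primeCounting', Nat.count_eq_card_filter_range]
          apply Finset.card_le_card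
          intro p hp
          simp only [Finset.mem_filter, Finset.mem_Icc, Finset.mem_range] at hp ⊢
          refine ⟨?_, hp.2.1⟩
          have : N / m ≤ ⌊x / m⌋₊ := Nat.le_floor hdiv
          omega
        have h4 : lz ≤ Real.log (x / m) := by rwa [Real.le_log_iff_exp_le (by linarith)]
        calc _ ≤ ((⌊x / m⌋₊.primeCounting : ℕ):ℝ) := by exact_mod_cast h3
          _ ≤ _ := h2
          _ ≤ _ := by gcongr
      calc _ ≤ 2 * (m.divisors.card : ℝ) * (5 * (x / m) / lz) := by gcongr
        _ = _ := by unfold wt; ring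
    refine (Finset.sum_le_sum hterm).trans ?_
    rw [← Finset.mul_sum]
    calc _ ≤ 10 * x / lz * (CG * u ^ (1.99:ℝ)) := by gcongr
      _ = 10 * CG * (x * u ^ (0.995:ℝ)) := by
          have : u ^ (1.99:ℝ) = lz * u ^ (0.995:ℝ) := by rw [hlz, ← Real.rpow_add hlx]; norm_num
          rw [this]; field_simp
      _ ≤ _ := by
          gcongr 10 * CG * (x * ?_)
          exact Real.rpow_le_rpow_of_exponent_le (by linarith) (by norm_num)
  have hb : ∑ n ∈ (Finset.Icc 1 N).filter (fun n => n ∈ BsetE θ ∧ ∀ q : ℕ, q.Prime → q ∣ n → q ≤ Z), (n.divisors.card : ℝ)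
      ≤ c2 ^ C3 * D * (x * u ^ (0.99998:ℝ)) := by
    set σ := 1 / lz with hσ
    have hσ0 : 0 ≤ σ := by positivity
    have hσ1 : σ ≤ 1/2 := by rw [hσ]; gcongr
    have hZ1 : σ * Real.log Z ≤ 1 := by
      have : Real.log Z ≤ lz := by
        rcases Nat.eq_zero_or_pos Z with h | h
        · rw [h]; simp; linarith
        · calc Real.log Z ≤ Real.log (Real.exp lz) := by
                apply Real.log_le_log (by exact_mod_cast h); exact Nat.floor_le (Real.exp_pos _).le
            _ = lz := Real.log_exp _
      rw [hσ, one_div, inv_mul_le_iff₀ (by linarith)]; linarith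
    have h1 := hR θ N Z σ hσ0 hσ1 hZ1
    have h2 : Real.exp (C3 * Sp Z) ≤ c2 ^ C3 * u ^ C3 := by
      have h3 : Real.exp (Sp N) ≤ c2 * u := by
        refine (hcc N hN2).2.trans ?_
        gcongr
        exact Real.log_le_log (by positivity) hNx
      rw [← Real.mul_rpow hc2.le hlx.le]
      calc _ ≤ Real.exp (C3 * Sp N) := by gcongr; exact Sp_mono hZN
        _ = (Real.exp (Sp N)) ^ C3 := by rw [← Real.exp_mul, mul_comm]
        _ ≤ _ := by gcongr
    have hsub : ∑ n ∈ (Finset.Icc 1 N).filter (fun n => n ∈ BsetE θ ∧ ∀ q : ℕ, q.Prime → q ∣ n → q ≤ Z), wt n * (n:ℝ)^σ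
        ≤ ∑ n ∈ Gs θ N 1 0 Z, wt n * (n:ℝ)^σ := by
      apply Finset.sum_le_sum_of_subset_of_nonneg
      · intro n hn
        simp only [Finset.mem_filter, Finset.mem_Icc] at hn
        exact Gs_complete Z n hn.2.1 hn.2.2 (hfac n hn.1.1 hn.1.2)
      · intro n _ _; exact mul_nonneg (wt_nonneg n) (by positivity)
    have hxs : x ^ (1 - σ) = x * Real.exp (-(u ^ (0.005:ℝ))) := by
      rw [Real.rpow_sub hx0, Real.rpow_one, Real.rpow_def_of_pos hx0 σ, Real.exp_neg, ← hu, div_eq_mul_inv]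
      congr 3
      have : u = lz * u ^ (0.005:ℝ) := by rw [hlz, ← Real.rpow_add hlx]; norm_num
      rw [hσ]
      nth_rewrite 1 [this]
      field_simp
    calc _ ≤ ∑ n ∈ (Finset.Icc 1 N).filter (fun n => n ∈ BsetE θ ∧ ∀ q : ℕ, q.Prime → q ∣ n → q ≤ Z), x ^ (1 - σ) * (wt n * (n:ℝ)^σ) := by
          apply Finset.sum_le_sum
          intro n hn
          simp only [Finset.mem_filter, Finset.mem_Icc] at hn
          have hn0 : (0:ℝ) < n := by exact_mod_cast hn.1.1
          have hnx : (n:ℝ) ≤ x := le_trans (by exact_mod_cast hn.1.2) hNx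
          have h5 : (n:ℝ) ^ (1 - σ) ≤ x ^ (1-σ) := by
            apply Real.rpow_le_rpow hn0.le hnx; linarith
          have h6 : (n:ℝ) ^ (1 - σ) * (wt n * (n:ℝ)^σ) = n.divisors.card := by
            rw [Real.rpow_sub hn0, Real.rpow_one]
            unfold wt
            have : (n:ℝ)^σ ≠ 0 := by positivity
            field_simp
          rw [← h6]
          have : 0 ≤ wt n * (n:ℝ)^σ := mul_nonneg (wt_nonneg n) (by positivity)
          gcongr
      _ = x ^ (1 - σ) * ∑ n ∈ (Finset.Icc 1 N).filter (fun n => n ∈ BsetE θ ∧ ∀ q : ℕ, q.Prime → q ∣ n → q ≤ Z), (wt n * (n:ℝ)^σ) := by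
          rw [Finset.mul_sum]
      _ ≤ x ^ (1 - σ) * (c2 ^ C3 * u ^ C3) := by gcongr; exact hsub.trans (h1.trans h2)
      _ ≤ x * Real.exp (-(u ^ (0.005:ℝ))) * (c2 ^ C3 * (D * Real.exp (u ^ (0.005:ℝ)))) := by
          rw [hxs]; gcongr; exact hDD u (by linarith)
      _ = c2 ^ C3 * D * (x * 1) * (Real.exp (-(u ^ (0.005:ℝ))) * Real.exp (u ^ (0.005:ℝ))) := by ring
      _ = c2 ^ C3 * D * (x * 1) := by rw [← Real.exp_add]; simp
      _ ≤ _ := by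
          gcongr
          exact Real.one_le_rpow (by linarith) (by norm_num)
  rw [hsplit]
  have h5 : 0 ≤ Cs * (x * u ^ (0.99998 : ℝ)) := by positivity
  linarith

noncomputable def hl (ρ : ℝ) : ℝ := Real.log ρ - 0.004 * (ρ - 1)

lemma hl_nonneg {ρ : ℝ} (h1 : 1 ≤ ρ) (h2 : ρ ≤ 2) : 0.496 * (1 - 1/ρ) ≤ hl ρ := by
  unfold hl
  have h3 := Real.one_sub_inv_le_log_of_pos (show 0 < ρ by linarith)
  rw [← one_div] at h3
  have h4 : ρ - 1 ≤ 2 * (1 - 1/ρ) := by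
    have : ρ * (1 - 1/ρ) = ρ - 1 := by field_simp
    have h5 : 0 ≤ 1 - 1/ρ := by rw [sub_nonneg, div_le_one (by linarith)]; exact h1
    nlinarith
  have h5 : 0 ≤ 1 - 1/ρ := by rw [sub_nonneg, div_le_one (by linarith)]; exact h1
  linarith

lemma hl_nonpos {ρ : ℝ} (h0 : 0 < ρ) (h1 : ρ ≤ 1) : hl ρ ≤ 0 := by
  unfold hl
  have := Real.log_le_sub_one_of_pos h0
  linarith

lemma hl_nonpos' {ρ : ℝ} (h1 : 2000 ≤ ρ) : hl ρ ≤ 0 := by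
  unfold hl
  have h2 := Real.log_le_sub_one_of_pos (show 0 < ρ/1000 by linarith)
  have e : Real.log ρ = Real.log (ρ/2000) + Real.log 2000 := by
    rw [← Real.log_mul (by positivity) (by norm_num)]; congr 1; ring
  have h3 : Real.log (ρ/2000) ≤ 0.004 * (ρ - 2000) := by
    have := Real.log_le_sub_one_of_pos (show 0 < ρ/2000 by linarith)
    linarith
  have h4 : Real.log 2000 ≤ 7.99 := by
    have h5 : Real.log 2000 ≤ Real.log (2^11) := Real.log_le_log (by norm_num) (by norm_num)
    rw [Real.log_pow] at h5
    have := Real.log_two_lt_d9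
    push_cast at h5
    linarith
  linarith

lemma hl_le {ρ : ℝ} (h1 : 1 ≤ ρ) (h2 : ρ ≤ 2000) : hl ρ ≤ 8 := by
  unfold hl
  have h4 : Real.log ρ ≤ 7.99 := by
    have h5 : Real.log ρ ≤ Real.log (2^11) := Real.log_le_log (by linarith) (by norm_num; linarith)
    rw [Real.log_pow] at h5
    have := Real.log_two_lt_d9
    push_cast at h5
    linarith
  linarith

lemma exp_num1 : Real.exp 0.2322 ≤ 1 / 0.7925 := by
  refine (Real.exp_bound' (by norm_num) (by norm_num) (n := 6) (by norm_num)).trans ?_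
  simp [Finset.sum_range_succ, Nat.factorial]
  norm_num

lemma exp_num2 : Real.exp 1.5715 ≤ 1 / 0.2075 := by
  have h : Real.exp 0.78575 ≤ 2.1945 := by
    refine (Real.exp_bound' (by norm_num) (by norm_num) (n := 8) (by norm_num)).trans ?_
    simp [Finset.sum_range_succ, Nat.factorial]
    norm_num
  have e : Real.exp 1.5715 = Real.exp 0.78575 * Real.exp 0.78575 := by rw [← Real.exp_add]; norm_num
  rw [e]
  have := Real.exp_pos 0.78575
  norm_num at h ⊢
  nlinarith

lemma core_log {r l : ℝ} (hr : 0 < r) (hl : 0 < l) :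
    1.585 * Real.log r + 0.415 * Real.log l + 1.0202 ≤ 2 * Real.log (r + l) := by
  have h1 := strictConcaveOn_log_Ioi.concaveOn.2 (show r / 0.7925 ∈ Set.Ioi (0:ℝ) from Set.mem_Ioi.2 (by positivity))
    (show l / 0.2075 ∈ Set.Ioi (0:ℝ) from Set.mem_Ioi.2 (by positivity)) (show (0:ℝ) ≤ 0.7925 by norm_num) (show (0:ℝ) ≤ 0.2075 by norm_num) (by norm_num)
  simp only [smul_eq_mul] at h1
  have e : 0.7925 * (r / 0.7925) + 0.2075 * (l / 0.2075) = r + l := by ring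
  rw [e, div_eq_mul_one_div r, div_eq_mul_one_div l, Real.log_mul hr.ne' (by norm_num), Real.log_mul hl.ne' (by norm_num)] at h1
  have h2 : 0.2322 ≤ Real.log (1/0.7925) := by rw [Real.le_log_iff_exp_le (by norm_num)]; exact exp_num1
  have h3 : 1.5715 ≤ Real.log (1/0.2075) := by rw [Real.le_log_iff_exp_le (by norm_num)]; exact exp_num2
  linarith

lemma lower_core {r l x : ℝ} (hr : 1 ≤ r) (hl1 : 0.97 ≤ l) (hl2 : l ≤ 1) (hx : 0 < x) (hx2 : x ≤ 0.0001) :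
    (1 + 1.585 * x) * hl r ≤ hl (r * Real.exp (-x)) + 2 * x * hl ((r + l) * Real.exp (-x)) := by
  have hr0 : 0 < r := by linarith
  have hl0 : 0 < l := by linarith
  have h1 := core_log hr0 hl0
  have h2 : -0.031 ≤ Real.log l := by
    have := Real.one_sub_inv_le_log_of_pos hl0
    have : l⁻¹ ≤ 1.031 := by rw [inv_le_comm₀ hl0 (by norm_num)]; linarith
    linarith
  have h3 := exp_neg_le hx.le (by linarith)
  have h3' : Real.exp (-x) ≤ 1 := Real.exp_le_one_iff.2 (by linarith)
  unfold hl
  rw [Real.log_mul hr0.ne' (Real.exp_pos _).ne', Real.log_mul (by positivity) (Real.exp_pos _).ne', Real.log_exp]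
  have h4 : r * Real.exp (-x) ≤ r * (1 - x + x^2) := by gcongr
  have h5 : (r + l) * Real.exp (-x) ≤ r + l := mul_le_of_le_one_right (by linarith) h3'
  have h6 : 0 ≤ -1 - 2 * x + 2 * Real.log (r + l) - 1.585 * Real.log r + 0.004 * ((0.585 - x) * r - 2 * l + 0.415) := by
    have : 0.58 ≤ (0.585 - x) * r := by nlinarith
    linarith
  have h7 : 2 * x * (Real.log (r + l) - x - 0.004 * (r + l - 1)) ≤ 2 * x * (Real.log (r + l) + -x - 0.004 * ((r + l) * Real.exp (-x) - 1)) := by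
    gcongr ?_ * ?_
    linarith
  have h8 := mul_nonneg hx.le h6
  have h9 : (Real.log r - x - 0.004 * (r * (1 - x + x^2) - 1)) + 2 * x * (Real.log (r + l) - x - 0.004 * (r + l - 1)) - (1 + 1.585 * x) * (Real.log r - 0.004 * (r - 1))
     = x * (-1 - 2 * x + 2 * Real.log (r + l) - 1.585 * Real.log r + 0.004 * ((0.585 - x) * r - 2 * l + 0.415)) := by ring
  linarith

noncomputable def Hl (L t : ℝ) : ℝ := if L ≤ t then hl (t / L) else 0

lemma Hl_ge {L t : ℝ} (hL : 0 < L) (ht : 0 < t) : hl (t / L) ≤ Hl L t := by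
  unfold Hl
  split_ifs with h
  · exact le_rfl
  · push Not at h
    exact hl_nonpos (by positivity) ((div_le_one hL).2 h.le)

lemma lower_step {L t p : ℝ} (hL : 0 < L) (hp : 10000 ≤ p)
    (h1 : 0.97 * L ≤ Real.log p) (h2 : Real.log p ≤ L) (alive : Prop) (hal : L ≤ t → alive) :
    (1 + 1.585 / p) * Hl L t ≤ Hl (L * Real.exp (1/p)) t + if alive then 2 / p * Hl (L * Real.exp (1/p)) (t + Real.log p) else 0 := by
  have hp0 : 0 < p := by linarith
  set x := 1 / p with hx
  have hx0 : 0 < x := by positivity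
  have hx1 : x ≤ 0.0001 := by rw [hx, div_le_iff₀ hp0]; linarith
  have hLe : L ≤ L * Real.exp x := le_mul_of_one_le_right hL.le (Real.one_le_exp hx0.le)
  have hLe0 : 0 < L * Real.exp x := by positivity
  have hlp : 0 < Real.log p := Real.log_pos (by linarith)
  by_cases h : L ≤ t
  · have ht0 : 0 < t := by linarith
    rw [if_pos (hal h)]
    have e1 : Hl L t = hl (t / L) := by unfold Hl; rw [if_pos h]
    have h3 := Hl_ge hLe0 ht0
    have h4 := Hl_ge hLe0 (show 0 < t + Real.log p by linarith)
    have hr : 1 ≤ t / L := by rw [le_div_iff₀ hL]; linarith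
    have h5 := lower_core hr (l := Real.log p / L) (by rw [le_div_iff₀ hL]; exact h1) ((div_le_one hL).2 h2) hx0 hx1
    have e2 : t / (L * Real.exp x) = t / L * Real.exp (-x) := by rw [Real.exp_neg]; field_simp
    have e3 : (t + Real.log p) / (L * Real.exp x) = (t / L + Real.log p / L) * Real.exp (-x) := by rw [Real.exp_neg]; field_simp
    rw [e2] at h3
    rw [e3] at h4
    rw [e1, show 1.585 / p = 1.585 * x by rw [hx]; ring, show 2 / p = 2 * x by rw [hx]; ring]
    have h6 := mul_le_mul_of_nonneg_left h4 (show 0 ≤ 2 * x by positivity)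
    linarith
  · have e1 : Hl L t = 0 := by unfold Hl; rw [if_neg h]
    push Not at h
    have e2 : Hl (L * Real.exp x) t = 0 := by unfold Hl; rw [if_neg (by push Not; linarith)]
    rw [e1, e2, mul_zero, zero_add]
    split_ifs
    · apply mul_nonneg (by positivity)
      unfold Hl
      split_ifs with h6
      · have h7 : 1 ≤ (t + Real.log p) / (L * Real.exp x) := by rw [le_div_iff₀ hLe0]; linarith
        have h8 : (t + Real.log p) / (L * Real.exp x) ≤ 2 := by rw [div_le_iff₀ hLe0]; linarith
        refine le_trans ?_ (hl_nonneg h7 h8)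
        apply mul_nonneg (by norm_num)
        rw [sub_nonneg, div_le_one (by linarith)]; exact h7
      · exact le_rfl
    · exact le_rfl

lemma Gs_start {θ : ℕ → EReal} {A n0 N0 : ℕ} : ∀ N ≤ N0, Gs θ A n0 N0 N = {n0} := by
  intro N
  induction N with
  | zero => intro _; rfl
  | succ N ih =>
    intro h
    rw [Gs, if_neg (by omega), ih (by omega)]

set_option maxHeartbeats 1600000 in
theorem lower_G : ∃ (c : ℝ) (N1 : ℕ), 0 < c ∧ ∀ θ : ℕ → EReal,
    (∀ n : ℕ, 1 ≤ n → (((max 2 n : ℕ) : ℝ) : EReal) ≤ θ n) → ∀ N : ℕ, N1 ≤ N →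
    ∃ F : Finset ℕ, (∀ n ∈ F, n ∈ BsetE θ ∧ (∀ q : ℕ, q.Prime → q ∣ n → q ≤ N) ∧
      1.02 * Real.log N ≤ Real.log n ∧ Real.log n ≤ 2060 * Real.log N) ∧
      c * (Real.log N) ^ (1.58:ℝ) ≤ ∑ n ∈ F, wt n := by
  obtain ⟨c, hc, hlim⟩ := mertens_ratio
  obtain ⟨c1, c2, hc1, hc2, hcc⟩ := mertens_bounds
  have ev1 : ∀ᶠ N : ℕ in Filter.atTop, |c * Real.exp (Sp N) / Real.log N - 1| < 0.004 := by
    have := (Metric.tendsto_nhds.1 hlim) 0.004 (by norm_num)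
    simpa [Real.dist_eq] using this
  have ev4 : ∀ᶠ N : ℕ in Filter.atTop, 10000 ≤ (N:ℝ) := tendsto_natCast_atTop_atTop.eventually_ge_atTop _
  obtain ⟨N0, hN0⟩ := Filter.eventually_atTop.1 (ev1.and ev4)
  set Lf : ℕ → ℝ := fun N => 1.025 * c * Real.exp (Sp N) with hLf
  have hLpos : ∀ N, 0 < Lf N := fun N => by simp only [hLf]; positivity
  have hLs : ∀ N, (N+1).Prime → Lf (N+1) = Lf N * Real.exp (1 / ((N+1:ℕ):ℝ)) := fun N h => by
    simp only [hLf]; rw [Sp_succ, if_pos h, Real.exp_add]; ring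
  have hLn : ∀ N, ¬ (N+1).Prime → Lf (N+1) = Lf N := fun N h => by
    simp only [hLf]; rw [Sp_succ, if_neg h, add_zero]
  have hgood : ∀ N, N0 ≤ N → 1.02 * Real.log N ≤ Lf N ∧ Lf N ≤ 1.0292 * Real.log N := by
    intro N hN
    obtain ⟨h1, h4⟩ := hN0 N hN
    have hl : 0 < Real.log N := Real.log_pos (by linarith)
    have h5 := abs_lt.1 h1
    have e : Lf N = 1.025 * (c * Real.exp (Sp N) / Real.log N) * Real.log N := by
      simp only [hLf]; field_simp
    rw [e]
    constructor <;> gcongr <;> linarith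
  have hN01 := (hN0 N0 le_rfl).2
  have hl0 : 2 ≤ Real.log N0 := by
    rw [Real.le_log_iff_exp_le (by linarith)]
    have := Real.exp_one_lt_d9
    have e : Real.exp 2 = Real.exp 1 * Real.exp 1 := by rw [← Real.exp_add]; norm_num
    have := Real.exp_pos 1
    nlinarith
  have hL0 : 2 ≤ Lf N0 := by have := (hgood N0 le_rfl).1; linarith
  have hlog2 := Real.log_two_gt_d9
  have hlog2' := Real.log_two_lt_d9
  set k := ⌊2 * Lf N0 / Real.log 2⌋₊ with hk
  set n0 : ℕ := 2 ^ k with hn0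
  have hk1 : k * Real.log 2 ≤ 2 * Lf N0 := by
    rw [← le_div_iff₀ (by linarith)]; exact Nat.floor_le (by positivity)
  have hk2 : 2 * Lf N0 - Real.log 2 ≤ k * Real.log 2 := by
    have := Nat.lt_floor_add_one (2 * Lf N0 / Real.log 2)
    rw [div_lt_iff₀ (by linarith)] at this
    linarith
  have hkpos : 1 ≤ k := by
    by_contra hcon
    have : k = 0 := by omega
    rw [this] at hk2
    simp at hk2
    linarith
  have hlogn0 : Real.log n0 = k * Real.log 2 := by rw [hn0]; push_cast; rw [Real.log_pow]
  have hρ1 : 1.5 ≤ Real.log n0 / Lf N0 := by rw [le_div_iff₀ (hLpos _), hlogn0]; linarith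
  have hρ2 : Real.log n0 / Lf N0 ≤ 2 := by rw [div_le_iff₀ (hLpos _), hlogn0]; linarith
  have hwn0 : 0 < wt n0 := by
    unfold wt
    have : 0 < n0.divisors.card := Finset.card_pos.2 (Nat.nonempty_divisors.2 (by positivity))
    positivity
  set W := wt n0 * 0.1 with hW
  have hWpos : 0 < W := by positivity
  refine ⟨W * Real.exp (-(1.58 * Sp N0)) * c1 ^ (1.58:ℝ) / 8, N0, by positivity, fun θ hθ => ?_⟩
  have hθn : ∀ n : ℕ, 1 ≤ n → ((n:ℝ):EReal) ≤ θ n := fun n hn =>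
    le_trans (by exact_mod_cast le_max_right 2 n) (hθ n hn)
  have hgs : GoodStart θ n0 N0 := by
    constructor
    · have := (BsetE_mul (θ := θ) (m := 1) (p := 2) (a := k) one_pos Nat.prime_two
        (fun q hq h => absurd (Nat.dvd_one.1 h) hq.ne_one) hkpos).2 ⟨one_mem_BsetE, by simpa using hθ 1 le_rfl⟩
      simpa [hn0] using this
    · intro q hq hqn
      have h2 : q ∣ 2 := hq.dvd_of_dvd_pow hqn
      have : q ≤ 2 := Nat.le_of_dvd (by norm_num) h2
      have : (2:ℝ) ≤ N0 := by linarith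
      have : 2 ≤ N0 := by exact_mod_cast this
      omega
  have key : ∀ N, N0 ≤ N → W * Real.exp (1.58 * (Sp N - Sp N0)) ≤
      ∑ n ∈ Gs θ 1 n0 N0 N, wt n * Hl (Lf N) (Real.log n) := by
    intro N hN
    induction N, hN using Nat.le_induction with
    | base =>
      rw [Gs_start N0 le_rfl, Finset.sum_singleton, sub_self, mul_zero, Real.exp_zero, mul_one, hW]
      gcongr
      have h3 := hl_nonneg (show 1 ≤ Real.log n0 / Lf N0 by linarith) hρ2
      have h4 := Hl_ge (hLpos N0) (show 0 < Real.log n0 by rw [hlogn0]; nlinarith)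
      have h5 : 1 / (Real.log n0 / Lf N0) ≤ 1 / 1.5 := by gcongr
      norm_num at h5 h3 ⊢
      linarith
    | succ N hN ih =>
      rw [Gs_wsum hgs]
      by_cases hpr : (N+1).Prime
      swap
      · have e : Sp (N+1) = Sp N := by rw [Sp_succ, if_neg hpr, add_zero]
        rw [hLn N hpr, e]
        refine ih.trans (le_of_eq ?_)
        apply Finset.sum_congr rfl; intro m hm
        rw [if_neg (fun h => hpr h.1.1), add_zero]
      set p : ℝ := ((N+1:ℕ):ℝ) with hp
      have hsp : Sp (N+1) = Sp N + 1 / p := by rw [Sp_succ, if_pos hpr]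
      have hp1 : 10000 ≤ p := (hN0 (N+1) (by omega)).2
      have hg := hgood (N+1) (by omega)
      rw [← hp, hLs N hpr, ← hp] at hg
      have hlp1 : 0 < Real.log p := Real.log_pos (by linarith)
      have hx1 : 1 / p ≤ 0.0001 := by rw [div_le_iff₀ (by linarith)]; linarith
      have hx0 : 0 ≤ 1 / p := by positivity
      have hex : Real.exp (1/p) ≤ 1.001 := by
        have := (abs_le.1 (Real.abs_exp_sub_one_sub_id_le (x := 1/p) (by rw [abs_of_nonneg hx0]; linarith))).2
        nlinarith
      have hex1 : 1 ≤ Real.exp (1/p) := Real.one_le_exp hx0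
      have hLN := hLpos N
      have h1 : 0.97 * Lf N ≤ Real.log p := by nlinarith
      have h2 : Real.log p ≤ Lf N := by nlinarith
      have hstep : ∀ m ∈ Gs θ 1 n0 N0 N, (1 + 1.585 / p) * (wt m * Hl (Lf N) (Real.log m)) ≤
          wt m * (Hl (Lf (N+1)) (Real.log m) +
          if ((N+1).Prime ∧ N0 < N+1) ∧ ((p:ℝ):EReal) ≤ θ m then
            ∑ a ∈ Finset.Icc (1:ℕ) 1, (a+1:ℝ)/p^a * Hl (Lf (N+1)) (Real.log ((m * (N+1)^a : ℕ):ℝ)) else 0) := by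
        intro m hm
        have hm0 : 0 < m := (Gs_prop hgs N m hm).1.1
        rw [mul_left_comm]
        apply mul_le_mul_of_nonneg_left _ (wt_nonneg m)
        have h3 := lower_step hLN hp1 h1 h2 (((N+1).Prime ∧ N0 < N+1) ∧ ((p:ℝ):EReal) ≤ θ m) (t := Real.log m) (by
          intro hLt
          refine ⟨⟨hpr, by omega⟩, le_trans ?_ (hθn m hm0)⟩
          have h4 : Real.log p ≤ Real.log m := h2.trans hLt
          rw [Real.log_le_log_iff (by linarith) (by exact_mod_cast hm0)] at h4
          exact_mod_cast h4)
        refine h3.trans (le_of_eq ?_)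
        rw [← hLs N hpr]
        congr 1
        have e2 : ∑ a ∈ Finset.Icc (1:ℕ) 1, (a+1:ℝ)/p^a * Hl (Lf (N+1)) (Real.log ((m * (N+1)^a : ℕ):ℝ)) =
            2 / p * Hl (Lf (N+1)) (Real.log m + Real.log p) := by
          rw [Finset.Icc_self, Finset.sum_singleton, log_mul_pow hm0 (Nat.succ_pos N), ← hp, pow_one,
            Nat.cast_one, one_mul, one_add_one_eq_two]
        rw [e2]
        by_cases hcond : ((N+1).Prime ∧ N0 < N+1) ∧ ((p:ℝ):EReal) ≤ θ m
        · rw [if_pos hcond, if_pos hcond]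
        · rw [if_neg hcond, if_neg hcond]
      refine le_trans ?_ (Finset.sum_le_sum hstep)
      rw [← Finset.mul_sum]
      have hexp : Real.exp (1.58 * (1/p)) ≤ 1 + 1.585 / p := by
        have := (abs_le.1 (Real.abs_exp_sub_one_sub_id_le (x := 1.58 * (1/p)) (by rw [abs_of_nonneg (by positivity)]; linarith))).2
        have e : 1.585 / p = 1.585 * (1/p) := by ring
        rw [e]
        clear hstep h1 h2 hg hex hex1 ih
        generalize 1 / p = y at *
        have hyy : y * y ≤ 0.0001 * y := mul_le_mul_of_nonneg_right hx1 hx0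
        nlinarith
      calc _ = Real.exp (1.58 * (1/p)) * (W * Real.exp (1.58 * (Sp N - Sp N0))) := by
            rw [hsp, show 1.58 * (Sp N + 1/p - Sp N0) = 1.58 * (1/p) + 1.58 * (Sp N - Sp N0) by ring, Real.exp_add]; ring
        _ ≤ _ := by gcongr
  intro N hN
  have hk3 := key N hN
  refine ⟨(Gs θ 1 n0 N0 N).filter (fun n : ℕ => Lf N ≤ Real.log (n:ℝ) ∧ Real.log (n:ℝ) ≤ 2000 * Lf N), ?_, ?_⟩
  · intro n hn
    rw [Finset.mem_filter] at hn
    obtain ⟨h1, h2, h3⟩ := hn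
    have h4 := Gs_prop hgs N n h1
    rw [max_eq_left hN] at h4
    have h5 := hgood N hN
    exact ⟨h4.1, h4.2, by linarith, by linarith⟩
  · have hN2 : 2 ≤ N := by
      have := (hN0 N hN).2
      have : (2:ℝ) ≤ N := by linarith
      exact_mod_cast this
    have hlN : 0 < Real.log N := Real.log_pos (by exact_mod_cast hN2)
    have h1 : ∑ n ∈ Gs θ 1 n0 N0 N, wt n * Hl (Lf N) (Real.log n) ≤
        8 * ∑ n ∈ (Gs θ 1 n0 N0 N).filter (fun n : ℕ => Lf N ≤ Real.log (n:ℝ) ∧ Real.log (n:ℝ) ≤ 2000 * Lf N), wt n := by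
      rw [Finset.mul_sum, Finset.sum_filter]
      apply Finset.sum_le_sum
      intro n hn
      have hw := wt_nonneg n
      split_ifs with h
      · have : Hl (Lf N) (Real.log n) ≤ 8 := by
          unfold Hl
          rw [if_pos h.1]
          exact hl_le (by rw [le_div_iff₀ (hLpos N)]; linarith [h.1]) (by rw [div_le_iff₀ (hLpos N)]; exact h.2)
        nlinarith
      · have : Hl (Lf N) (Real.log n) ≤ 0 := by
          unfold Hl
          split_ifs with h2
          · have h3 : 2000 * Lf N < Real.log n := by
              by_contra h4
              push Not at h4
              exact h ⟨h2, h4⟩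
            exact hl_nonpos' (by rw [le_div_iff₀ (hLpos N)]; exact h3.le)
          · exact le_rfl
        nlinarith
    have h2 : c1 ^ (1.58:ℝ) * (Real.log N) ^ (1.58:ℝ) ≤ Real.exp (1.58 * Sp N) := by
      rw [← Real.mul_rpow hc1.le hlN.le, mul_comm (1.58:ℝ), Real.exp_mul]
      gcongr
      exact (hcc N hN2).1
    have h3 : W * Real.exp (1.58 * (Sp N - Sp N0)) = W * Real.exp (-(1.58 * Sp N0)) * Real.exp (1.58 * Sp N) := by
      rw [show 1.58 * (Sp N - Sp N0) = -(1.58 * Sp N0) + 1.58 * Sp N by ring, Real.exp_add]; ring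
    have h4 : W * Real.exp (-(1.58 * Sp N0)) * (c1 ^ (1.58:ℝ) * (Real.log N) ^ (1.58:ℝ)) ≤ W * Real.exp (-(1.58 * Sp N0)) * Real.exp (1.58 * Sp N) := by
      gcongr
    linarith

lemma ext_sum {F : Finset ℕ} {P : ℕ → Finset ℕ} {Y : ℕ}
    (hF : ∀ n ∈ F, 0 < n ∧ ∀ q : ℕ, q.Prime → q ∣ n → q ≤ Y)
    (hP : ∀ n ∈ F, ∀ p ∈ P n, p.Prime ∧ Y < p) (f : ℕ → ℝ) :
    ∑ m ∈ (F.sigma P).image (fun s => s.1 * s.2), f m = ∑ n ∈ F, ∑ p ∈ P n, f (n * p) := by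
  rw [Finset.sum_image, Finset.sum_sigma]
  rintro ⟨n, p⟩ h1 ⟨n', p'⟩ h2 h
  rw [Finset.mem_coe, Finset.mem_sigma] at h1 h2
  simp only at h1 h2 h
  obtain ⟨hp, hYp⟩ := hP n h1.1 p h1.2
  obtain ⟨hp', hYp'⟩ := hP n' h2.1 p' h2.2
  have d1 : p = p' := by
    have hd : p ∣ n' * p' := h ▸ Dvd.intro_left n rfl
    rcases hp.dvd_mul.1 hd with h3 | h3
    · have := (hF n' h2.1).2 p hp h3
      omega
    · exact (Nat.prime_dvd_prime_iff_eq hp hp').1 h3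
  subst d1
  have : n = n' := Nat.eq_of_mul_eq_mul_right hp.pos h
  subst this
  rfl

lemma Sp_diff {Y Z : ℕ} (h : Y ≤ Z) :
    ∑ p ∈ (Finset.Ioc Y Z).filter Nat.Prime, 1 / (p:ℝ) = Sp Z - Sp Y := by
  induction Z, h using Nat.le_induction with
  | base => simp
  | succ Z hZ ih =>
    rw [Finset.sum_filter] at ih ⊢
    rw [← Finset.insert_Ioc_right_eq_Ioc_add_one hZ, Finset.sum_insert (by simp), ih, Sp_succ]
    ring

lemma ext_step {θ : ℕ → EReal} (hθ : ∀ n : ℕ, 1 ≤ n → ((n:ℝ):EReal) ≤ θ n) {F : Finset ℕ}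
    {Y Z lo hi : ℕ} (hYZ : Y ≤ Z) (hZ : Z ≤ lo)
    (hF : ∀ n ∈ F, n ∈ BsetE θ ∧ (∀ q : ℕ, q.Prime → q ∣ n → q ≤ Y) ∧ lo ≤ n ∧ n ≤ hi) :
    ∃ F' : Finset ℕ, (∀ n ∈ F', n ∈ BsetE θ ∧ (∀ q : ℕ, q.Prime → q ∣ n → q ≤ Z) ∧
      lo * Y ≤ n ∧ n ≤ hi * Z) ∧ ∑ n ∈ F', wt n = 2 * (Sp Z - Sp Y) * ∑ n ∈ F, wt n := by
  refine ⟨(F.sigma (fun _ => (Finset.Ioc Y Z).filter Nat.Prime)).image (fun s => s.1 * s.2), ?_, ?_⟩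
  · intro m hm
    rw [Finset.mem_image] at hm
    obtain ⟨⟨n, p⟩, h1, rfl⟩ := hm
    simp only [Finset.mem_sigma, Finset.mem_filter, Finset.mem_Ioc] at h1
    obtain ⟨hn, ⟨hYp, hpZ⟩, hp⟩ := h1
    obtain ⟨hB, hq, hlo, hhi⟩ := hF n hn
    have hn0 : 0 < n := hB.1
    refine ⟨?_, ?_, ?_, ?_⟩
    · have := (BsetE_mul (θ := θ) (a := 1) hn0 hp
        (fun q h1 h2 => lt_of_le_of_lt (hq q h1 h2) hYp) le_rfl).2 ⟨hB, le_trans ?_ (hθ n hn0)⟩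
      · simpa using this
      · exact_mod_cast (hpZ.trans hZ).trans hlo
    · intro q h1 h2
      rcases h1.dvd_mul.1 h2 with h3 | h3
      · exact (hq q h1 h3).trans hYZ
      · rw [(Nat.prime_dvd_prime_iff_eq h1 hp).1 h3]; exact hpZ
    · exact Nat.mul_le_mul hlo hYp.le
    · exact Nat.mul_le_mul hhi hpZ
  · rw [ext_sum (Y := Y) (fun n hn => ⟨(hF n hn).1.1, (hF n hn).2.1⟩)
      (fun n hn p hp => by
        simp only [Finset.mem_filter, Finset.mem_Ioc] at hp
        exact ⟨hp.2, hp.1.1⟩), Finset.mul_sum]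
    apply Finset.sum_congr rfl
    intro n hn
    rw [← Sp_diff hYZ, Finset.mul_sum, Finset.sum_mul]
    apply Finset.sum_congr rfl
    intro p hp
    simp only [Finset.mem_filter, Finset.mem_Ioc] at hp
    have := wt_mul (m := n) (p := p) (a := 1) hp.2 (fun hd => by
      have := (hF n hn).2.1 p hp.2 hd
      omega)
    rw [pow_one] at this
    rw [this]
    push_cast
    ring

lemma ext_iter {θ : ℕ → EReal} (hθ : ∀ n : ℕ, 1 ≤ n → ((n:ℝ):EReal) ≤ θ n) {F : Finset ℕ}
    {M J k a b : ℕ} {δ : ℝ} (hM : 1 ≤ M) (hδ : 0 ≤ δ) (hab : J + k ≤ a)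
    (hS : ∀ j, J ≤ j → j < J + k → δ ≤ Sp (M^(j+1)) - Sp (M^j))
    (hF : ∀ n ∈ F, n ∈ BsetE θ ∧ (∀ q : ℕ, q.Prime → q ∣ n → q ≤ M^J) ∧ M^a ≤ n ∧ n ≤ M^b) :
    ∀ i ≤ k, ∃ F' : Finset ℕ, (∀ n ∈ F', n ∈ BsetE θ ∧
      (∀ q : ℕ, q.Prime → q ∣ n → q ≤ M^(J+i)) ∧
      M^(a + i * J) ≤ n ∧ n ≤ M^(b + (J+k)*i)) ∧ (2*δ)^i * ∑ n ∈ F, wt n ≤ ∑ n ∈ F', wt n := by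
  intro i
  induction i with
  | zero => intro _; exact ⟨F, by simpa using hF, by simp⟩
  | succ i ih =>
    intro hi
    obtain ⟨F1, h1, h2⟩ := ih (by omega)
    obtain ⟨F2, h3, h4⟩ := ext_step hθ (Y := M^(J+i)) (Z := M^(J+i+1))
      (Nat.pow_le_pow_right hM (by omega)) (Nat.pow_le_pow_right hM (by
        have : 0 ≤ i * J := Nat.zero_le _
        omega)) h1
    refine ⟨F2, ?_, ?_⟩
    · intro n hn
      obtain ⟨a1, a2, a3, a4⟩ := h3 n hn
      refine ⟨a1, a2, ?_, ?_⟩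
      · refine le_trans ?_ a3
        rw [← pow_add]
        apply Nat.pow_le_pow_right hM
        rw [add_mul]; omega
      · refine a4.trans ?_
        rw [← pow_add]
        apply Nat.pow_le_pow_right hM
        rw [mul_add]; omega
    · rw [h4]
      have h5 := hS (J+i) (by omega) (by omega)
      have h6 : 0 ≤ (2*δ)^i * ∑ n ∈ F, wt n :=
        mul_nonneg (by positivity) (Finset.sum_nonneg (fun n _ => wt_nonneg n))
      calc (2*δ)^(i+1) * ∑ n ∈ F, wt n = 2 * δ * ((2*δ)^i * ∑ n ∈ F, wt n) := by ring
        _ ≤ _ := mul_le_mul (by linarith) h2 h6 (by linarith)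

lemma mertens_pow (j0 : ℕ) : ∃ δ : ℝ, 0 < δ ∧ ∃ M0 : ℕ, ∀ M, M0 ≤ M → ∀ j, 1 ≤ j → j ≤ j0 →
    δ ≤ Sp (M^(j+1)) - Sp (M^j) := by
  obtain ⟨c, hc, hlim⟩ := mertens_ratio
  refine ⟨Real.log (1 + 1/(2*(j0+1))), Real.log_pos (by
    have : (0:ℝ) < 1/(2*(j0+1)) := by positivity
    linarith), ?_⟩
  have hpw : ∀ j : ℕ, 1 ≤ j → Filter.Tendsto (fun M : ℕ => M^j) Filter.atTop Filter.atTop :=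
    fun j hj => Filter.tendsto_pow_atTop (by omega)
  have key : ∀ j ∈ Finset.Icc 1 j0, ∀ᶠ M : ℕ in Filter.atTop,
      Real.log (1 + 1/(2*(j0+1))) ≤ Sp (M^(j+1)) - Sp (M^j) := by
    intro j hj
    rw [Finset.mem_Icc] at hj
    have hj0 : (1:ℝ) ≤ j := by exact_mod_cast hj.1
    have hjj : (j:ℝ) ≤ j0 := by exact_mod_cast hj.2
    have t1 := hlim.comp (hpw (j+1) (by omega))
    have t2 := hlim.comp (hpw j hj.1)
    have t3 := (t1.div t2 one_ne_zero).mul_const (((j+1:ℕ):ℝ)/j)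
    have hlt : 1 + 1/(2*((j0:ℝ)+1)) < 1 / 1 * (((j+1:ℕ):ℝ)/j) := by
      have : 1/(2*((j0:ℝ)+1)) < 1 / j := by
        apply one_div_lt_one_div_of_lt <;> linarith
      have e : 1 / 1 * (((j+1:ℕ):ℝ)/j) = 1 + 1 / j := by push_cast; field_simp
      rw [e]; linarith
    filter_upwards [t3.eventually (lt_mem_nhds hlt), Filter.eventually_ge_atTop 2] with M h1 h2
    have hl : 0 < Real.log M := Real.log_pos (by exact_mod_cast h2)
    have e : ((fun N : ℕ => c * Real.exp (Sp N) / Real.log N) ∘ fun M : ℕ => M^(j+1)) M /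
        ((fun N : ℕ => c * Real.exp (Sp N) / Real.log N) ∘ fun M : ℕ => M^j) M * (((j+1:ℕ):ℝ)/j)
        = Real.exp (Sp (M^(j+1)) - Sp (M^j)) := by
      simp only [Function.comp]
      rw [Real.exp_sub]
      simp only [Nat.cast_pow, Real.log_pow]
      have := Real.exp_pos (Sp (M^j))
      field_simp
    rw [Real.log_le_iff_le_exp (by positivity)]
    have h3 := h1.le
    simp only [Pi.div_apply] at h3
    rw [e] at h3
    exact h3
  rw [← Filter.eventually_all_finset] at key
  obtain ⟨M0, hM0⟩ := Filter.eventually_atTop.1 key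
  exact ⟨M0, fun M hM j h1 h2 => hM0 M hM j (Finset.mem_Icc.2 ⟨h1, h2⟩)⟩

lemma prime_count_lower {v : ℝ} (hv : (10:ℝ)^12 ≤ v) {Y : ℕ} (hY : (Y:ℝ)^2 ≤ v) :
    v / (4 * Real.log v) ≤ (((Finset.Ioc Y ⌊v⌋₊).filter Nat.Prime).card : ℝ) := by
  have hv1 : 1 < v := lt_of_lt_of_le (by norm_num) hv
  have hpi := Chebyshev.pi_ge' hv1
  have hlv : 0 < Real.log v := Real.log_pos hv1
  set s := Real.sqrt v with hs
  set w := Real.sqrt s with hw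
  have hss : s ^ 2 = v := Real.sq_sqrt (by linarith)
  have hww : w ^ 2 = s := Real.sq_sqrt (Real.sqrt_nonneg _)
  have hw0 : 0 ≤ w := Real.sqrt_nonneg _
  have hw4 : w ^ 4 = v := by rw [← hss, ← hww]; ring
  have hw1 : 1000 ≤ w := by
    by_contra h
    push Not at h
    have : w ^ 4 < 1000 ^ 4 := by gcongr
    rw [hw4] at this
    norm_num at hv this
    linarith
  have hYs : (Y:ℝ) ≤ s := Real.le_sqrt_of_sq_le hY
  have hlw : Real.log v ≤ 4 * w := by
    rw [← hw4, Real.log_pow]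
    have := Real.log_le_sub_one_of_pos (show 0 < w by linarith)
    push_cast; linarith
  have hl2 : Real.log (v+2) ≤ 8 * w := by
    have : Real.log (v + 2) ≤ Real.log (v ^ 2) := by
      apply Real.log_le_log (by linarith); nlinarith
    rw [Real.log_pow] at this
    push_cast at this
    linarith
  have hlog2 := Real.log_two_gt_d9
  have hcount : (⌊v⌋₊.primeCounting : ℝ) ≤ Y + (((Finset.Ioc Y ⌊v⌋₊).filter Nat.Prime).card : ℝ) := by
    have : ⌊v⌋₊.primeCounting ≤ Y + ((Finset.Ioc Y ⌊v⌋₊).filter Nat.Prime).card := by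
      rw [Nat.primeCounting, Nat.primeCounting', Nat.count_eq_card_filter_range]
      calc _ ≤ (Finset.Icc 1 Y ∪ (Finset.Ioc Y ⌊v⌋₊).filter Nat.Prime).card := by
            apply Finset.card_le_card
            intro p hp
            simp only [Finset.mem_filter, Finset.mem_range, Finset.mem_union, Finset.mem_Icc, Finset.mem_Ioc] at hp ⊢
            have := hp.2.pos
            by_cases h : p ≤ Y
            · left; omega
            · right; exact ⟨⟨by omega, by omega⟩, hp.2⟩
        _ ≤ _ := (Finset.card_union_le _ _).trans (by simp)
    exact_mod_cast this
  have main : v / (4 * Real.log v) + s ≤ ((v - 1) * Real.log 2 - Real.log (v + 2)) / Real.log v := by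
    rw [le_div_iff₀ hlv, add_mul]
    have e : v / (4 * Real.log v) * Real.log v = v / 4 := by field_simp
    rw [e]
    have h1 : s * Real.log v ≤ s * (4 * w) := by
      apply mul_le_mul_of_nonneg_left hlw (Real.sqrt_nonneg _)
    have h2 : (v-1) * 0.6931471803 ≤ (v-1) * Real.log 2 := by
      apply mul_le_mul_of_nonneg_left hlog2.le; linarith
    have h3 : s * (4*w) = 4 * w^3 := by rw [← hww]; ring
    have h4 : 1000 * w^3 ≤ v := by rw [← hw4]; nlinarith [pow_nonneg hw0 3]
    have h5 : 1000^2 * w ≤ w^3 := by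
      have : (1000:ℝ)^2 ≤ w^2 := by gcongr
      nlinarith
    norm_num at h5
    linarith
  linarith

lemma T_nonneg_one {θ : ℕ → EReal} {x : ℝ} (hx : 2 ≤ x) : 1 ≤ Tθ θ x := by
  unfold Tθ
  have h1 : 1 ∈ (Finset.Icc 1 ⌊x⌋₊).filter (fun n => n ∈ BsetE θ) := by
    rw [Finset.mem_filter, Finset.mem_Icc]
    exact ⟨⟨le_rfl, Nat.le_floor (by push_cast; linarith)⟩, one_mem_BsetE⟩
  have := Finset.single_le_sum (f := fun n : ℕ => (n.divisors.card : ℝ)) (fun i _ => by positivity) h1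
  simpa using this

/-- last step: append one big prime -/
lemma T_from_F {θ : ℕ → EReal} (hθ : ∀ n : ℕ, 1 ≤ n → ((n:ℝ):EReal) ≤ θ n) {F : Finset ℕ} {Y : ℕ} {x : ℝ}
    (hx : 2 ≤ x)
    (hF : ∀ n ∈ F, n ∈ BsetE θ ∧ (∀ q : ℕ, q.Prime → q ∣ n → q ≤ Y) ∧ x ≤ (n:ℝ)^2 ∧
      (Y:ℝ)^2 ≤ x / n ∧ (10:ℝ)^12 ≤ x / n) :
    x / (2 * Real.log x) * ∑ n ∈ F, wt n ≤ Tθ θ x := by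
  set P : ℕ → Finset ℕ := fun n => (Finset.Ioc Y ⌊x / n⌋₊).filter Nat.Prime with hP
  have hPm : ∀ n p, p ∈ P n ↔ (Y < p ∧ p ≤ ⌊x/n⌋₊) ∧ p.Prime := fun n p => by
    simp only [hP, Finset.mem_filter, Finset.mem_Ioc]
  have hsub : (F.sigma P).image (fun s => s.1 * s.2) ⊆
      (Finset.Icc 1 ⌊x⌋₊).filter (fun n => n ∈ BsetE θ) := by
    intro m hm
    rw [Finset.mem_image] at hm
    obtain ⟨⟨n, p⟩, h1, rfl⟩ := hm
    rw [Finset.mem_sigma, hPm] at h1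
    obtain ⟨hn, ⟨hYp, hpZ⟩, hp⟩ := h1
    simp only at hn hYp hpZ hp ⊢
    obtain ⟨hB, hq, hx1, hx2, hx3⟩ := hF n hn
    have hn0 : 0 < n := hB.1
    have hnr : (0:ℝ) < n := by exact_mod_cast hn0
    have hpx : (p:ℝ) ≤ x / n := (Nat.le_floor_iff (by positivity)).1 hpZ
    rw [Finset.mem_filter, Finset.mem_Icc]
    refine ⟨⟨Nat.mul_pos hn0 hp.pos, Nat.le_floor ?_⟩, ?_⟩
    · push_cast
      rw [le_div_iff₀ hnr] at hpx
      linarith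
    · have := (BsetE_mul (θ := θ) (a := 1) hn0 hp
        (fun q h1 h2 => lt_of_le_of_lt (hq q h1 h2) hYp) le_rfl).2 ⟨hB, le_trans ?_ (hθ n hn0)⟩
      · simpa using this
      · have : x / n ≤ n := by rw [div_le_iff₀ hnr]; nlinarith
        exact_mod_cast hpx.trans this
  have hT : ∑ n ∈ F, ∑ p ∈ P n, ((n*p).divisors.card : ℝ) ≤ Tθ θ x := by
    rw [← ext_sum (Y := Y) (fun n hn => ⟨(hF n hn).1.1, (hF n hn).2.1⟩)
      (fun n hn p hp => ⟨((hPm n p).1 hp).2, ((hPm n p).1 hp).1.1⟩) (fun m => ((m.divisors.card : ℕ) : ℝ))]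
    unfold Tθ
    exact Finset.sum_le_sum_of_subset_of_nonneg hsub (fun i _ _ => by positivity)
  refine le_trans ?_ hT
  rw [Finset.mul_sum]
  apply Finset.sum_le_sum
  intro n hn
  obtain ⟨hB, hq, hx1, hx2, hx3⟩ := hF n hn
  have hn0 : 0 < n := hB.1
  have hnr : (1:ℝ) ≤ n := by exact_mod_cast hn0
  have hcard : ∀ p ∈ P n, ((n*p).divisors.card : ℝ) = 2 * n.divisors.card := by
    intro p hp
    rw [hPm] at hp
    have hnd : ¬ p ∣ n := fun h => by have := hq p hp.2 h; omega
    have hc : Nat.Coprime n p := (hp.2.coprime_iff_not_dvd.2 hnd).symm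
    rw [hc.card_divisors_mul, hp.2.divisors, Finset.card_pair hp.2.one_lt.ne]
    push_cast; ring
  rw [Finset.sum_congr rfl hcard, Finset.sum_const, nsmul_eq_mul]
  have hcnt := prime_count_lower hx3 hx2
  have hlv : 0 < Real.log (x/n) := Real.log_pos (lt_of_lt_of_le (by norm_num) hx3)
  have hle : Real.log (x/n) ≤ Real.log x := by
    apply Real.log_le_log (lt_of_lt_of_le (by norm_num) hx3)
    exact div_le_self (by linarith) hnr
  calc x / (2 * Real.log x) * wt n = (x/n) / (4 * Real.log x) * (2 * n.divisors.card) := by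
        unfold wt
        have : 0 < Real.log x := by linarith
        field_simp
        ring
    _ ≤ (x/n) / (4 * Real.log (x/n)) * (2 * n.divisors.card) := by
        have : 0 ≤ x / n := by positivity
        gcongr
    _ ≤ _ := by gcongr

lemma root_exists (E : ℕ) (hE : 1 ≤ E) {x : ℝ} (hx : 1 ≤ x) :
    ∃ M : ℕ, (M:ℝ)^E ≤ x ∧ x < ((M:ℝ)+1)^E := by
  refine ⟨⌊x ^ ((1:ℝ)/E)⌋₊, ?_, ?_⟩
  · have h1 : (⌊x ^ ((1:ℝ)/E)⌋₊ : ℝ) ≤ x ^ ((1:ℝ)/E) := Nat.floor_le (by positivity)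
    calc _ ≤ (x ^ ((1:ℝ)/E))^E := by gcongr
      _ = x := by rw [one_div, Real.rpow_inv_natCast_pow (by linarith) (by omega)]
  · have h1 := Nat.lt_floor_add_one (x ^ ((1:ℝ)/E))
    calc x = (x ^ ((1:ℝ)/E))^E := by rw [one_div, Real.rpow_inv_natCast_pow (by linarith) (by omega)]
      _ < _ := pow_lt_pow_left₀ h1 (by positivity) (by omega)

lemma T_lower_core (k J a b A B E : ℕ) (hJ1 : 1 ≤ J) (ha : J + k ≤ a) (ha2 : (a:ℝ) = 1.02 * J)
    (hb : b = 2060 * J) (hA : A = a + k * J) (hB : B = b + (J+k)*k) (hE : E + 1 = 2 * A)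
    (hEB : B + 2 * (J+k) ≤ E) :
    ∃ (c X0 : ℝ), 0 < c ∧ ∀ θ : ℕ → EReal,
    (∀ n : ℕ, 1 ≤ n → (((max 2 n : ℕ) : ℝ) : EReal) ≤ θ n) → ∀ x : ℝ, X0 ≤ x →
    c * (x * Real.log x ^ (0.58:ℝ)) ≤ Tθ θ x := by
  obtain ⟨c0, N1, hc0, hG⟩ := lower_G
  obtain ⟨δ, hδ, M0, hM0⟩ := mertens_pow (J+k)
  obtain ⟨Q, hQ⟩ : ∃ Q : ℕ, Q = M0 + N1 + 2^E + 10^12 := ⟨_, rfl⟩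
  have hE1 : 1 ≤ E := by omega
  have hκ : (0:ℝ) < J / (E+1) := by positivity
  refine ⟨1/2 * ((2*δ)^k * (c0 * (J/(E+1):ℝ)^(1.58:ℝ))), 2 + ((Q:ℝ)+1)^E, by positivity, ?_⟩
  intro θ hθ x hx
  have hθn : ∀ n : ℕ, 1 ≤ n → ((n:ℝ):EReal) ≤ θ n := fun n hn =>
    le_trans (by exact_mod_cast le_max_right 2 n) (hθ n hn)
  have hQp : (0:ℝ) ≤ ((Q:ℝ)+1)^E := by positivity
  have hx2 : 2 ≤ x := by linarith
  obtain ⟨M, hM1, hM2⟩ := root_exists E hE1 (show 1 ≤ x by linarith)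
  have hMQ : Q ≤ M := by
    by_contra h
    push Not at h
    have : ((M:ℝ)+1)^E ≤ ((Q:ℝ)+1)^E := by
      have : (M:ℝ) ≤ Q := by exact_mod_cast h.le
      gcongr
    linarith
  have hM2E : 2^E ≤ M := by omega
  have hM12 : 10^12 ≤ M := le_trans (by rw [hQ]; exact Nat.le_add_left _ _) hMQ
  have hMM0 : M0 ≤ M := le_trans (by rw [hQ, add_assoc, add_assoc]; exact Nat.le_add_right _ _) hMQ
  have hMN1 : N1 ≤ M := le_trans (by rw [hQ, add_comm M0 N1, add_assoc, add_assoc]; exact Nat.le_add_right _ _) hMQ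
  have hMone : 1 ≤ M := le_trans (by norm_num) hM12
  have hMr12 : (10:ℝ)^12 ≤ M := by exact_mod_cast hM12
  have hMr : (1:ℝ) ≤ M := by exact_mod_cast hMone
  have hMr1 : (1:ℝ) < M := lt_of_lt_of_le (by norm_num) hMr12
  have hlM : 0 < Real.log M := Real.log_pos hMr1
  have hxM : x ≤ (M:ℝ)^(E+1) := by
    calc x ≤ ((M:ℝ)+1)^E := hM2.le
      _ ≤ (2*(M:ℝ))^E := by gcongr; linarith
      _ = 2^E * (M:ℝ)^E := by rw [mul_pow]
      _ ≤ M * (M:ℝ)^E := by gcongr; exact_mod_cast hM2E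
      _ = _ := by ring
  have hMpos : (0:ℝ) < M := by linarith
  obtain ⟨F, hF1, hF2⟩ := hG θ hθ (M^J) (hMN1.trans (Nat.le_self_pow (by omega) M))
  have hlN : Real.log ((M^J : ℕ):ℝ) = J * Real.log M := by rw [Nat.cast_pow, Real.log_pow]
  rw [hlN] at hF2
  have hF3 : ∀ n ∈ F, n ∈ BsetE θ ∧ (∀ q : ℕ, q.Prime → q ∣ n → q ≤ M^J) ∧ M^a ≤ n ∧ n ≤ M^b := by
    intro n hn
    obtain ⟨h1, h2, h3, h4⟩ := hF1 n hn
    rw [hlN] at h3 h4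
    have hn0 : (0:ℝ) < n := by exact_mod_cast h1.1
    refine ⟨h1, h2, ?_, ?_⟩
    · have : (M:ℝ)^a ≤ n := by
        rw [← Real.log_le_log_iff (by positivity) hn0, Real.log_pow, ha2]
        linarith
      exact_mod_cast this
    · have : (n:ℝ) ≤ (M:ℝ)^b := by
        rw [← Real.log_le_log_iff hn0 (by positivity), Real.log_pow, hb]
        push_cast; linarith
      exact_mod_cast this
  obtain ⟨F', hF4, hF5⟩ := ext_iter hθn hMone hδ.le ha
    (fun j h1 h2 => hM0 M hMM0 j (by omega) (by omega)) hF3 k le_rfl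
  rw [← hA, ← hB] at hF4
  have hfin := T_from_F (x := x) hθn (F := F') (Y := M^(J+k)) hx2 (by
    intro n hn
    obtain ⟨h1, h2, h3, h4⟩ := hF4 n hn
    have hn0 : (0:ℝ) < n := by exact_mod_cast h1.1
    have h3r : (M:ℝ)^A ≤ n := by exact_mod_cast h3
    have h4r : (n:ℝ) ≤ (M:ℝ)^B := by exact_mod_cast h4
    have h5 : ((M:ℝ)^(J+k))^2 ≤ x / n := by
      rw [le_div_iff₀ hn0]
      calc ((M:ℝ)^(J+k))^2 * n ≤ ((M:ℝ)^(J+k))^2 * (M:ℝ)^B := by gcongr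
        _ = (M:ℝ)^(B + 2*(J+k)) := by rw [← pow_mul, ← pow_add]; congr 1; ring
        _ ≤ (M:ℝ)^E := pow_le_pow_right₀ hMr hEB
        _ ≤ x := hM1
    refine ⟨h1, h2, ?_, by push_cast; exact h5, ?_⟩
    · calc x ≤ (M:ℝ)^(E+1) := hxM
        _ = ((M:ℝ)^A)^2 := by rw [hE, ← pow_mul, mul_comm]
        _ ≤ _ := by gcongr
    · refine le_trans hMr12 (le_trans ?_ h5)
      rw [← pow_mul]
      exact le_self_pow₀ hMr (by omega))
  have hlx : 0 < Real.log x := Real.log_pos (by linarith)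
  have hlx2 : Real.log x ≤ (E+1) * Real.log M := by
    have := Real.log_le_log (by linarith) hxM
    rw [Real.log_pow] at this
    push_cast at this
    exact this
  have hS0 : c0 * ((J/(E+1):ℝ)^(1.58:ℝ) * Real.log x ^ (1.58:ℝ)) ≤ ∑ n ∈ F, wt n := by
    refine le_trans ?_ hF2
    rw [← Real.mul_rpow hκ.le hlx.le]
    apply mul_le_mul_of_nonneg_left _ hc0.le
    apply Real.rpow_le_rpow (by positivity) _ (by norm_num)
    rw [div_mul_eq_mul_div, div_le_iff₀ (by positivity)]
    nlinarith [mul_le_mul_of_nonneg_left hlx2 (Nat.cast_nonneg (α := ℝ) J)]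
  have hlog : Real.log x ^ (1.58:ℝ) = Real.log x * Real.log x ^ (0.58:ℝ) := by
    rw [show (1.58:ℝ) = 1 + 0.58 by norm_num, Real.rpow_add hlx, Real.rpow_one]
  refine le_trans ?_ hfin
  calc _ = x / (2 * Real.log x) * ((2*δ)^k * (c0 * ((J/(E+1):ℝ)^(1.58:ℝ) * Real.log x ^ (1.58:ℝ)))) := by
        rw [hlog]
        generalize (J/(E+1):ℝ)^(1.58:ℝ) = u
        generalize Real.log x ^ (0.58:ℝ) = w
        field_simp
    _ ≤ x / (2 * Real.log x) * ∑ n ∈ F', wt n := by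
        gcongr
        exact le_trans (by gcongr) hF5

theorem T_lower : ∃ c : ℝ, 0 < c ∧ ∀ θ : ℕ → EReal,
    (∀ n : ℕ, 1 ≤ n → (((max 2 n : ℕ) : ℝ) : EReal) ≤ θ n) → ∀ x : ℝ, 2 ≤ x →
    c * (x * Real.log x ^ (0.58:ℝ)) ≤ Tθ θ x := by
  obtain ⟨c, X0, hc, h⟩ := T_lower_core 2103 105150 107253 216609000 221237703 442162059 442475405
    (by norm_num) (by norm_num) (by norm_num) (by norm_num) (by norm_num) (by norm_num) (by norm_num) (by norm_num)
  set X := max X0 2 with hX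
  have hX2 : 2 ≤ X := le_max_right _ _
  have hlX : 0 < Real.log X := Real.log_pos (by linarith)
  have hD : 0 < X * Real.log X ^ (0.58:ℝ) := by positivity
  refine ⟨min c (1 / (X * Real.log X ^ (0.58:ℝ))), lt_min hc (by positivity), fun θ hθ x hx => ?_⟩
  have hlx : 0 < Real.log x := Real.log_pos (by linarith)
  by_cases hxX : X0 ≤ x
  · refine le_trans ?_ (h θ hθ x hxX)
    gcongr
    exact min_le_left _ _
  · push Not at hxX
    refine le_trans ?_ (T_nonneg_one hx)
    have hxX2 : x ≤ X := hxX.le.trans (le_max_left _ _)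
    calc _ ≤ 1 / (X * Real.log X ^ (0.58:ℝ)) * (X * Real.log X ^ (0.58:ℝ)) := by
          gcongr
          exact min_le_right _ _
      _ = 1 := by field_simp

theorem L1cor (K : ℝ) :
    ∃ c C : ℝ, 0 < c ∧ ∀ θ : ℕ → EReal,
      (∀ n : ℕ, 1 ≤ n → (((max 2 n : ℕ) : ℝ) : EReal) ≤ θ n) →
      (∀ n : ℕ, 1 ≤ n → θ n ≤ ((K * (n : ℝ) ^ 2 : ℝ) : EReal)) →
      (∀ x : ℝ, 2 ≤ x →
        c * (x * Real.log x ^ (0.58 : ℝ)) ≤ Tθ θ x ∧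
        Tθ θ x ≤ C * (x * Real.log x ^ (0.99998 : ℝ))) ∧
      Lconst θ = 1 := by
  obtain ⟨c, hc, hlow⟩ := T_lower
  obtain ⟨C, hC, hup⟩ := T_upper K
  obtain ⟨CG, hCG, hG⟩ := upper_G K
  refine ⟨c, C, hc, fun θ h1 h2 => ⟨fun x hx => ⟨hlow θ h1 x hx, hup θ h2 x hx⟩, ?_⟩⟩
  exact L_eq_one (fun n hn => le_trans (by exact_mod_cast le_max_right 2 n) (h1 n hn)) h2 (hG θ h2)
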